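/- arXiv:1408.5266 — 2 statements merged into one kernel-verified Lean document; each statement's English description precedes it below -/
import Mathlib

section
/- The initial-boundary value problem ∂φ/∂t + ∂φ/∂y + r(i) s ∂φ/∂s + ½ σ(i)² s² ∂²φ/∂s² + (f(y|i)/(1−F(y|i))) Σ_{j≠i} p_{ij} (φ(t,s,j,0) − φ(t,s,i,y)) = r(i) φ(t,s,i,y) on D, with φ(t,0,i,y) = 0 for all t ∈ [0,T] and φ(T,s,i,y) = (s−K)⁺ for s > 0, 0 ≤ y ≤ T and every i, has exactly one classical solution in the class of functions with at most linear growth (continuous on the closure of D and of class C^{1,2,1} on D). -/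
open MeasureTheory Real Set Finset

/-- Standard normal cumulative distribution function. -/
noncomputable def stdNormalCDF (x : ℝ) : ℝ :=
  ∫ u in Set.Iic x, Real.exp (-u ^ 2 / 2) / Real.sqrt (2 * Real.pi)

/-- Black–Scholes price of a European call with rate `r`, volatility `σ`,
strike `K`, maturity `T`, evaluated at time `t` and stock price `s`;
with `η(t,0)=0` and `η(T,s)=(s-K)⁺`. -/
noncomputable def bsPrice (r σ K T t s : ℝ) : ℝ :=
  if s ≤ 0 then 0
  else if t < T then
    s * stdNormalCDF ((Real.log (s / K) + (r + σ ^ 2 / 2) * (T - t)) / (σ * Real.sqrt (T - t)))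
      - K * Real.exp (-r * (T - t)) *
        stdNormalCDF ((Real.log (s / K) + (r + σ ^ 2 / 2) * (T - t)) / (σ * Real.sqrt (T - t))
          - σ * Real.sqrt (T - t))
  else max (s - K) 0

/-- `L(x,s,i,v)` of the lognormal kernel. -/
noncomputable def lnL (r σ x s v : ℝ) : ℝ :=
  (Real.log (x / s) - (r - σ ^ 2 / 2) * v) / (σ * Real.sqrt v)

/-- The lognormal kernel `α(x; s, i, v)`. -/
noncomputable def lnKernel (r σ x s v : ℝ) : ℝ :=
  Real.exp (-(lnL r σ x s v) ^ 2 / 2) / (Real.sqrt (2 * Real.pi) * x * σ * Real.sqrt v)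

/-- The domain `D` (in the variables `(t, s, y)`, the regime being kept separate). -/
def domD (T : ℝ) : Set (ℝ × ℝ × ℝ) :=
  {q | 0 < q.1 ∧ q.1 < T ∧ 0 < q.2.1 ∧ 0 < q.2.2 ∧ q.2.2 < q.1}

/-- The closure of the domain `D`. -/
def domDbar (T : ℝ) : Set (ℝ × ℝ × ℝ) :=
  {q | 0 ≤ q.1 ∧ q.1 ≤ T ∧ 0 ≤ q.2.1 ∧ 0 ≤ q.2.2 ∧ q.2.2 ≤ q.1}

/-- The right hand side of the Volterra integral equation. -/
noncomputable def ieRHS {k : ℕ} (r σ : Fin k → ℝ) (p : Fin k → Fin k → ℝ)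
    (f F : Fin k → ℝ → ℝ) (K T : ℝ) (φ : ℝ → ℝ → Fin k → ℝ → ℝ)
    (t s : ℝ) (i : Fin k) (y : ℝ) : ℝ :=
  (1 - F i (T - t + y)) / (1 - F i y) * bsPrice (r i) (σ i) K T t s
    + ∫ v in Set.Ioo (0 : ℝ) (T - t),
        Real.exp (-(r i) * v) * (f i (y + v) / (1 - F i y)) *
          ∑ j, p i j * ∫ x in Set.Ioi (0 : ℝ), φ (t + v) x j 0 * lnKernel (r i) (σ i) x s v

/-- Continuity on the closure of `D`. -/
def ContOnClosure (T : ℝ) {k : ℕ} (φ : ℝ → ℝ → Fin k → ℝ → ℝ) : Prop :=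
  ∀ i, ContinuousOn (fun q : ℝ × ℝ × ℝ => φ q.1 q.2.1 i q.2.2) (domDbar T)

/-- At most linear growth in the stock variable: `sup_D |φ|/(1+s) < ∞`. -/
def LinGrowth (T : ℝ) {k : ℕ} (φ : ℝ → ℝ → Fin k → ℝ → ℝ) : Prop :=
  ∃ C : ℝ, ∀ t s y : ℝ, (t, s, y) ∈ domD T → ∀ i, |φ t s i y| ≤ C * (1 + s)

/-- `φ` solves the Volterra integral equation together with boundary condition
`φ(t,0,i,y) = 0`. -/
def SolvesIE {k : ℕ} (r σ : Fin k → ℝ) (p : Fin k → Fin k → ℝ)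
    (f F : Fin k → ℝ → ℝ) (K T : ℝ) (φ : ℝ → ℝ → Fin k → ℝ → ℝ) : Prop :=
  (∀ t s y : ℝ, (t, s, y) ∈ domD T → ∀ i,
      φ t s i y = ieRHS r σ p f F K T φ t s i y) ∧
  (∀ t y : ℝ, ∀ i, 0 ≤ t → t ≤ T → 0 ≤ y → y ≤ t → φ t 0 i y = 0)

/-- `φ` is a classical solution of the initial-boundary value problem: continuous
on the closure of `D`, of class `C^{1,2,1}` on `D`, satisfying the non-local PDE
and the boundary/terminal conditions. -/
def IsClassicalSol {k : ℕ} (r σ : Fin k → ℝ) (p : Fin k → Fin k → ℝ)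
    (f F : Fin k → ℝ → ℝ) (K T : ℝ) (φ : ℝ → ℝ → Fin k → ℝ → ℝ) : Prop :=
  ContOnClosure T φ ∧
  (∀ t y : ℝ, ∀ i, 0 ≤ t → t ≤ T → 0 ≤ y → y ≤ t → φ t 0 i y = 0) ∧
  (∀ s : ℝ, 0 < s → ∀ y : ℝ, 0 ≤ y → y ≤ T → ∀ i, φ T s i y = max (s - K) 0) ∧
  ∃ Dt Ds Dss Dy : ℝ → ℝ → Fin k → ℝ → ℝ,
    (∀ t s y : ℝ, (t, s, y) ∈ domD T → ∀ i,
      HasDerivAt (fun τ => φ τ s i y) (Dt t s i y) t ∧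
      HasDerivAt (fun w => φ t w i y) (Ds t s i y) s ∧
      HasDerivAt (fun w => Ds t w i y) (Dss t s i y) s ∧
      HasDerivAt (fun u => φ t s i u) (Dy t s i y) y ∧
      Dt t s i y + Dy t s i y + r i * s * Ds t s i y
        + (1 / 2) * (σ i) ^ 2 * s ^ 2 * Dss t s i y
        + (f i y / (1 - F i y)) *
            ∑ j ∈ Finset.univ.erase i, p i j * (φ t s j 0 - φ t s i y)
        = r i * φ t s i y) ∧
    (∀ i, ContinuousOn (fun q : ℝ × ℝ × ℝ => Dt q.1 q.2.1 i q.2.2) (domD T) ∧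
          ContinuousOn (fun q : ℝ × ℝ × ℝ => Ds q.1 q.2.1 i q.2.2) (domD T) ∧
          ContinuousOn (fun q : ℝ × ℝ × ℝ => Dss q.1 q.2.1 i q.2.2) (domD T) ∧
          ContinuousOn (fun q : ℝ × ℝ × ℝ => Dy q.1 q.2.1 i q.2.2) (domD T))



/-- Extension of a `C¹` function on `[0,∞)` to a `C¹` function on the line. -/
lemma aux_extend (f : ℝ → ℝ) (hf : ContDiffOn ℝ 1 f (Set.Ici 0)) :
    ∃ g g' : ℝ → ℝ, Continuous g' ∧ (∀ x, HasDerivAt g (g' x) x) ∧ ∀ x, 0 ≤ x → g x = f x := by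
  have hd : ContinuousOn (derivWithin f (Set.Ici 0)) (Set.Ici 0) :=
    hf.continuousOn_derivWithin (uniqueDiffOn_Ici 0) le_rfl
  have hc : Continuous (fun x : ℝ => derivWithin f (Set.Ici 0) (max x 0)) :=
    hd.comp_continuous (by fun_prop) (fun x => by simp)
  refine ⟨fun x => f 0 + ∫ u in (0:ℝ)..x, derivWithin f (Set.Ici 0) (max u 0), _, hc, ?_, ?_⟩
  · intro x
    exact (intervalIntegral.integral_hasDerivAt_right (hc.intervalIntegrable _ _)
      (hc.stronglyMeasurableAtFilter _ _) hc.continuousAt).const_add _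
  · intro x hx
    have h := intervalIntegral.integral_eq_sub_of_hasDeriv_right_of_le (f := f)
      (f' := fun x : ℝ => derivWithin f (Set.Ici 0) (max x 0)) hx
      (hf.continuousOn.mono (fun y hy => hy.1)) ?_ (hc.intervalIntegrable _ _)
    · simp only [h]; ring
    · intro y hy
      have h1 : DifferentiableWithinAt ℝ f (Set.Ici 0) y :=
        (hf.differentiableOn one_ne_zero) y hy.1.le
      have h2 := h1.hasDerivWithinAt
      rw [max_eq_left hy.1.le]
      exact h2.mono (fun z hz => (hy.1.trans hz).le)

lemma aux_param (F F' : ℝ → ℝ → ℂ) (hF : ∀ x t, HasDerivAt (fun x => F x t) (F' x t) x)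
    (hFc : Continuous (Function.uncurry F)) (hF' : Continuous (Function.uncurry F')) (a b x : ℝ) :
    HasDerivAt (fun x => ∫ t in a..b, F x t) (∫ t in a..b, F' x t) x := by
  obtain ⟨C, hC⟩ := ((isCompact_closedBall x 1).prod (isCompact_uIcc (a := a) (b := b))).exists_bound_of_continuousOn
    hF'.continuousOn
  refine (intervalIntegral.hasDerivAt_integral_of_dominated_loc_of_deriv_le (F := F) (F' := F')
    (bound := fun _ => C) (Metric.closedBall_mem_nhds x one_pos) ?_ ?_ ?_ ?_ ?_ ?_).2
  · refine Filter.Eventually.of_forall fun y => ?_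
    exact (hFc.comp (Continuous.prodMk_right y)).aestronglyMeasurable
  · exact (hFc.comp (Continuous.prodMk_right x)).intervalIntegrable _ _
  · exact (hF'.comp (Continuous.prodMk_right x)).aestronglyMeasurable
  · refine Filter.Eventually.of_forall fun t ht y hy => ?_
    exact hC (y, t) ⟨hy, uIoc_subset_uIcc ht⟩
  · exact continuous_const.intervalIntegrable _ _
  · exact Filter.Eventually.of_forall fun t _ y _ => hF y t

/-- Leibniz rule for a convolution with variable end point. -/
lemma aux_leibniz (H H' n : ℝ → ℂ) (hH : ∀ x, HasDerivAt H (H' x) x) (hH' : Continuous H')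
    (hn : Continuous n) (τ : ℝ) :
    HasDerivAt (fun τ => ∫ w in (0:ℝ)..τ, H (τ - w) * n w)
      ((∫ w in (0:ℝ)..τ, H' (τ - w) * n w) + H 0 * n τ) τ := by
  have hHc : Continuous H := continuous_iff_continuousAt.2 fun x => (hH x).continuousAt
  have h1 : ∀ q x : ℝ, HasDerivAt (fun q => ∫ w in (0:ℝ)..x, H (q - w) * n w)
      (∫ w in (0:ℝ)..x, H' (q - w) * n w) q := fun q x =>
    aux_param (fun q w => H (q - w) * n w) (fun q w => H' (q - w) * n w)
      (fun q w => ((hH (q - w)).comp_sub_const q w).mul_const _) (by fun_prop) (by fun_prop) 0 x q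
  have h2 : ∀ q x : ℝ, HasDerivAt (fun x => ∫ w in (0:ℝ)..x, H (q - w) * n w)
      (H (q - x) * n x) x := by
    intro q x
    have hc : Continuous fun w => H (q - w) * n w := by fun_prop
    exact intervalIntegral.integral_hasDerivAt_right (hc.intervalIntegrable _ _)
      (hc.stronglyMeasurableAtFilter _ _) hc.continuousAt
  have hc1 : Continuous fun v : ℝ × ℝ => ∫ w in (0:ℝ)..v.2, H' (v.1 - w) * n w :=
    intervalIntegral.continuous_parametric_intervalIntegral_of_continuous
      (f := fun (v : ℝ × ℝ) w => H' (v.1 - w) * n w) (by fun_prop) continuous_snd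
  have hs := hasStrictFDerivAt_uncurry_coprod (𝕜 := ℝ) (u := (τ, τ))
    (f := fun q x => ∫ w in (0:ℝ)..x, H (q - w) * n w)
    (f₁ := fun q x => ContinuousLinearMap.toSpanSingleton ℝ (∫ w in (0:ℝ)..x, H' (q - w) * n w))
    (f₂ := fun q x => ContinuousLinearMap.toSpanSingleton ℝ (H (q - x) * n x))
    (Filter.Eventually.of_forall fun v => (h1 v.1 v.2).hasFDerivAt)
    (Filter.Eventually.of_forall fun v => (h2 v.1 v.2).hasFDerivAt)
    (by
      have : Continuous fun v : ℝ × ℝ => ContinuousLinearMap.toSpanSingleton ℝ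
        (∫ w in (0:ℝ)..v.2, H' (v.1 - w) * n w) :=
        (ContinuousLinearMap.toSpanSingletonCLE (𝕜 := ℝ) (E := ℂ)).continuous.comp hc1
      exact this.continuousAt)
    (by
      have : Continuous fun v : ℝ × ℝ => ContinuousLinearMap.toSpanSingleton ℝ
        (H (v.1 - v.2) * n v.2) :=
        (ContinuousLinearMap.toSpanSingletonCLE (𝕜 := ℝ) (E := ℂ)).continuous.comp
          (by fun_prop)
      exact this.continuousAt)
  have hd := HasFDerivAt.comp_hasDerivAt (f := fun x : ℝ => (x, x)) τ hs.hasFDerivAt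
    ((hasDerivAt_id' τ).prodMk (hasDerivAt_id' τ))
  simpa [Function.HasUncurry.uncurry, Function.comp_def] using! hd

lemma aux_second (g g' : ℝ → ℝ) (x d : ℝ) (hg : ∀ᶠ y in nhds x, HasDerivAt g (g' y) y)
    (hd : HasDerivAt g' d x) (hm : IsLocalMax g x) : g' x = 0 ∧ d ≤ 0 := by
  have h0 : g' x = 0 := hm.hasDerivAt_eq_zero hg.self_of_nhds
  refine ⟨h0, ?_⟩
  by_contra hpos
  push Not at hpos
  have e1 : deriv g =ᶠ[nhds x] g' := hg.mono fun y hy => hy.deriv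
  have hmin : IsLocalMin g x := by
    apply isLocalMin_of_deriv_deriv_pos
    · rw [e1.deriv_eq, hd.deriv]; exact hpos
    · rw [hg.self_of_nhds.deriv, h0]
    · exact hg.self_of_nhds.continuousAt
  have hconst : g =ᶠ[nhds x] fun _ => g x := by
    filter_upwards [hm, hmin] with y h1 h2 using le_antisymm h1 h2
  have e2 : g' =ᶠ[nhds x] fun _ => 0 := by
    filter_upwards [hconst.eventuallyEq_nhds, hg] with y h1 h2
    have := h1.deriv_eq
    rw [h2.deriv] at this
    simpa using this
  have := e2.deriv_eq
  rw [hd.deriv] at this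
  simp at this
  linarith

lemma aux_lor_int : Integrable (fun ω : ℝ => 1 / (2 * π * (1/4 + ω^2))) := by
  have h := (ProbabilityTheory.integrable_cauchyPDFReal 0 (γ := 1/2))
  refine h.congr (Filter.Eventually.of_forall fun ω => ?_)
  simp only [ProbabilityTheory.cauchyPDFReal_def]
  have := Real.pi_pos
  push_cast
  field_simp
  ring

lemma aux_fourier (x : ℝ) :
    ∫ ω : ℝ, Complex.exp (ω * x * Complex.I) * ((1 / (2 * π * (1/4 + ω^2)) : ℝ) : ℂ)
    = (Real.exp (-|x|/2) : ℝ) := by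
  have hpi := Real.pi_pos
  set h : ℝ → ℂ := fun x => ((Real.exp (-|x|/2) : ℝ) : ℂ) with hh
  have hcont : Continuous h := by fun_prop
  have e1 : ∀ a : ℂ, ∀ y ∈ Set.Ioi (0:ℝ), Complex.exp (a * y) * h y = Complex.exp ((a - 1/2) * y) := by
    intro a y hy
    simp only [hh, abs_of_pos (Set.mem_Ioi.1 hy), Complex.ofReal_exp, ← Complex.exp_add]
    congr 1; push_cast; ring
  have e2 : ∀ a : ℂ, ∀ y ∈ Set.Iic (0:ℝ), Complex.exp (a * y) * h y = Complex.exp ((a + 1/2) * y) := by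
    intro a y hy
    simp only [hh, abs_of_nonpos (Set.mem_Iic.1 hy), Complex.ofReal_exp, ← Complex.exp_add]
    congr 1; push_cast; ring
  have i1 : ∀ a : ℂ, a.re = 0 → IntegrableOn (fun y : ℝ => Complex.exp (a * y) * h y) (Set.Ioi 0) := by
    intro a ha
    rw [integrableOn_congr_fun (e1 a) measurableSet_Ioi]
    exact integrableOn_exp_mul_complex_Ioi (by simp [ha]) 0
  have i2 : ∀ a : ℂ, a.re = 0 → IntegrableOn (fun y : ℝ => Complex.exp (a * y) * h y) (Set.Iic 0) := by
    intro a ha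
    rw [integrableOn_congr_fun (e2 a) measurableSet_Iic]
    exact integrableOn_exp_mul_complex_Iic (by simp [ha]) 0
  have hIntg : Integrable h := by
    rw [← integrableOn_univ, ← Set.Iic_union_Ioi (a := (0:ℝ))]
    have a1 := i1 0 rfl
    have a2 := i2 0 rfl
    simp only [zero_mul, Complex.exp_zero, one_mul] at a1 a2
    exact a2.union a1
  have hF : FourierTransform.fourier h = fun w : ℝ => ((1 / (1/4 + (2 * π * w)^2) : ℝ) : ℂ) := by
    funext w
    rw [Real.fourier_real_eq_integral_exp_smul]
    set a : ℂ := -2 * π * w * Complex.I with ha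
    have hre : a.re = 0 := by simp [ha]
    have e3 : (fun v : ℝ => Complex.exp (((-2 * π * v * w : ℝ) : ℂ) * Complex.I) • h v)
        = fun v : ℝ => Complex.exp (a * v) * h v := by
      funext v
      rw [smul_eq_mul]; congr 2; rw [ha]; push_cast; ring
    rw [e3, ← setIntegral_univ, ← Set.Iic_union_Ioi (a := (0:ℝ)),
      setIntegral_union (Set.Iic_disjoint_Ioi le_rfl) measurableSet_Ioi (i2 a hre) (i1 a hre),
      setIntegral_congr_fun measurableSet_Iic (e2 a), setIntegral_congr_fun measurableSet_Ioi (e1 a),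
      integral_exp_mul_complex_Iic (by simp [hre]), integral_exp_mul_complex_Ioi (by simp [hre])]
    have n1 : a + 1/2 ≠ 0 := fun h0 => by
      have := congrArg Complex.re h0
      simp [hre] at this
    have n2 : a - 1/2 ≠ 0 := fun h0 => by
      have := congrArg Complex.re h0
      simp [hre] at this
    have n3 : ((1/4 + (2 * π * w)^2 : ℝ) : ℂ) = - ((a + 1/2) * (a - 1/2)) := by
      rw [ha]; push_cast
      ring_nf
      simp only [Complex.I_sq]; ring
    rw [Complex.ofReal_div, n3]
    simp only [Complex.ofReal_zero, mul_zero, Complex.exp_zero, Complex.ofReal_one]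
    generalize hb : a + 1/2 = b at *
    have hb2 : a - 1/2 = b - 1 := by rw [← hb]; ring
    rw [hb2] at n2 ⊢
    field_simp
    ring
  have hFint : Integrable (FourierTransform.fourier h) := by
    rw [hF]
    apply Integrable.ofReal
    have := (aux_lor_int.const_mul (2 * π)).comp_mul_left' (by positivity : (2 * π) ≠ 0)
    refine this.congr (Filter.Eventually.of_forall fun w => ?_)
    have h3 : 1/4 + (2 * π * w)^2 ≠ 0 := by positivity
    have h4 : π ≠ 0 := hpi.ne'
    change 2 * π * (1 / (2 * π * (1 / 4 + (2 * π * w) ^ 2))) = 1 / (1/4 + (2 * π * w)^2)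
    generalize 1/4 + (2 * π * w)^2 = b at *
    field_simp
  have hinv := hIntg.fourierInv_fourier_eq hFint (v := x) hcont.continuousAt
  rw [hF, Real.fourierInv_eq'] at hinv
  rw [← show h x = ((Real.exp (-|x|/2) : ℝ) : ℂ) from rfl, ← hinv]
  have := Measure.integral_comp_mul_left (fun ω : ℝ => Complex.exp (ω * x * Complex.I) *
    ((1 / (2 * π * (1/4 + ω^2)) : ℝ) : ℂ)) (2 * π)
  rw [abs_of_pos (by positivity : (0:ℝ) < (2 * π)⁻¹), eq_comm, inv_smul_eq_iff₀ (by positivity)] at this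
  rw [this, ← integral_smul]
  congr 1
  funext w
  simp only [inner, smul_eq_mul, Complex.real_smul]
  have : ((1 / (2 * π * (1/4 + (2*π*w)^2)) : ℝ) : ℂ) = ((1 / (1/4 + (2 * π * w)^2) : ℝ) : ℂ) / (2 * π) := by
    push_cast; field_simp
  rw [this]
  have : (2 * π : ℂ) ≠ 0 := by exact_mod_cast (by positivity : (2 * π : ℝ) ≠ 0)
  have e5 : ((2 * π * w : ℝ) : ℂ) * x * Complex.I
      = ((2 * π * RCLike.re (x * star w) : ℝ) : ℂ) * Complex.I := by
    simp
    ring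
  rw [e5]
  generalize Complex.exp (((2 * π * RCLike.re (x * star w) : ℝ) : ℂ) * Complex.I) = E
  generalize ((1 / (1/4 + (2 * π * w)^2) : ℝ) : ℂ) = B
  push_cast
  generalize (2 * π : ℂ) = c at *
  field_simp


lemma aux_conv_bound (g : ℝ → ℝ) (hg : Continuous g) (hg0 : ∀ x, 0 ≤ x → 0 ≤ g x)
    (κ : ℂ) (hκ : κ.re ≤ 0) (S : ℝ → ℂ) (B τ : ℝ) (hτ : 0 ≤ τ)
    (hS : ∀ w, 0 ≤ w → w ≤ τ → ‖S w‖ ≤ B) :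
    ‖∫ w in (0:ℝ)..τ, (g (τ - w) : ℂ) * Complex.exp (κ * ((τ - w : ℝ) : ℂ)) * S w‖
      ≤ (∫ w in (0:ℝ)..τ, g w) * B := by
  have h1 : (∫ w in (0:ℝ)..τ, g w) * B = ∫ w in (0:ℝ)..τ, g (τ - w) * B := by
    rw [intervalIntegral.integral_mul_const, intervalIntegral.integral_comp_sub_left]
    simp
  rw [h1]
  refine intervalIntegral.norm_integral_le_of_norm_le hτ ?_ ?_
  · refine Filter.Eventually.of_forall fun w hw => ?_
    have hw2 : 0 ≤ τ - w := by linarith [hw.2]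
    have e1 : ‖Complex.exp (κ * ((τ - w : ℝ) : ℂ))‖ ≤ 1 := by
      rw [Complex.norm_exp, Real.exp_le_one_iff, Complex.re_mul_ofReal]
      exact mul_nonpos_of_nonpos_of_nonneg hκ hw2
    rw [norm_mul, norm_mul, Complex.norm_real, Real.norm_of_nonneg (hg0 _ hw2)]
    have := hS w hw.1.le hw.2
    have h0 := hg0 _ hw2
    calc g (τ - w) * ‖Complex.exp (κ * ((τ - w : ℝ) : ℂ))‖ * ‖S w‖ ≤ g (τ - w) * 1 * B := by gcongr
      _ = _ := by ring
  · exact (by fun_prop : Continuous fun w => g (τ - w) * B).intervalIntegrable _ _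

lemma aux_volterra_fix {k : ℕ} (T : ℝ) (hT : 0 < T) (p : Fin k → Fin k → ℝ)
    (hp0 : ∀ i j, 0 ≤ p i j) (hp1 : ∀ i, ∑ j, p i j = 1)
    (g : Fin k → ℝ → ℝ) (hg : ∀ i, Continuous (g i)) (hg0 : ∀ i x, 0 ≤ x → 0 ≤ g i x)
    (G : Fin k → ℝ → ℝ) (hG : ∀ i y, G i y = ∫ u in (0:ℝ)..y, g i u)
    (ρ : ℝ) (hρ0 : 0 ≤ ρ) (hρ1 : ρ < 1) (hGρ : ∀ i τ, 0 ≤ τ → τ ≤ T → G i τ ≤ ρ)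
    (κ : Fin k → ℝ → ℂ) (hκ : ∀ i, Continuous (κ i)) (hκ0 : ∀ i ω, (κ i ω).re ≤ 0) :
    ∃ N : Fin k → ℝ → ℝ → ℂ, (∀ i, Continuous (fun z : ℝ × ℝ => N i z.1 z.2)) ∧
      (∃ C, ∀ i τ ω, ‖N i τ ω‖ ≤ C) ∧
      ∀ i τ ω, 0 ≤ τ → τ ≤ T → N i τ ω = ((1 - G i τ : ℝ) : ℂ) * Complex.exp (κ i ω * τ) +
        ∫ w in (0:ℝ)..τ, (g i (τ - w) : ℂ) * Complex.exp (κ i ω * ((τ - w : ℝ) : ℂ)) *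
          ∑ j, (p i j : ℂ) * N j w ω := by
  classical
  set cl : ℝ → ℝ := fun τ => max 0 (min τ T) with hcl
  have hcl0 : ∀ τ, 0 ≤ cl τ := fun τ => le_max_left _ _
  have hclT : ∀ τ, cl τ ≤ T := fun τ => max_le hT.le (min_le_right _ _)
  have hclc : Continuous cl := by fun_prop
  have hcle : ∀ τ, 0 ≤ τ → τ ≤ T → cl τ = τ := fun τ h1 h2 => by
    simp [hcl, h1, h2]
  have hGc : ∀ i, Continuous (G i) := by
    intro i
    have : G i = fun y => ∫ u in (0:ℝ)..y, g i u := funext (hG i)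
    rw [this]
    exact intervalIntegral.continuous_primitive (fun a b => (hg i).intervalIntegrable a b) 0
  have hG0 : ∀ i τ, 0 ≤ τ → 0 ≤ G i τ := fun i τ hτ => by
    rw [hG]; exact intervalIntegral.integral_nonneg hτ fun u hu => hg0 i u hu.1
  have hsum : ∀ i (v : Fin k → ℂ), ‖∑ j, (p i j : ℂ) * v j‖ ≤ ‖v‖ := by
    intro i v
    calc ‖∑ j, (p i j : ℂ) * v j‖ ≤ ∑ j, p i j * ‖v‖ := by
          refine norm_sum_le_of_le _ fun j _ => ?_
          rw [norm_mul, Complex.norm_real, Real.norm_of_nonneg (hp0 i j)]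
          exact mul_le_mul_of_nonneg_left (norm_le_pi_norm v j) (hp0 i j)
      _ = ‖v‖ := by rw [← Finset.sum_mul, hp1, one_mul]
  let Φ0 : (ℝ × ℝ → Fin k → ℂ) → ℝ × ℝ → Fin k → ℂ := fun u z i =>
    ((1 - G i (cl z.1) : ℝ) : ℂ) * Complex.exp (κ i z.2 * ((cl z.1 : ℝ) : ℂ)) +
        ∫ w in (0:ℝ)..(cl z.1), (g i (cl z.1 - w) : ℂ) *
          Complex.exp (κ i z.2 * ((cl z.1 - w : ℝ) : ℂ)) * ∑ j, (p i j : ℂ) * u (w, z.2) j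
  have hΦc : ∀ u : ℝ × ℝ → Fin k → ℂ, Continuous u → Continuous (Φ0 u) := by
    intro u hu
    refine continuous_pi fun i => ?_
    have := hGc i
    have := hκ i
    have := hg i
    refine Continuous.add (by fun_prop) ?_
    exact intervalIntegral.continuous_parametric_intervalIntegral_of_continuous
      (f := fun (z : ℝ × ℝ) w => (g i (cl z.1 - w) : ℂ) *
          Complex.exp (κ i z.2 * ((cl z.1 - w : ℝ) : ℂ)) * ∑ j, (p i j : ℂ) * u (w, z.2) j)
      (by fun_prop) (by fun_prop)
  have hΦb : ∀ (u : BoundedContinuousFunction (ℝ × ℝ) (Fin k → ℂ)) z, ‖Φ0 u z‖ ≤ 1 + ρ * ‖u‖ := by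
    intro u z
    refine (pi_norm_le_iff_of_nonneg (by positivity)).2 fun i => ?_
    refine (norm_add_le _ _).trans (add_le_add ?_ ?_)
    · rw [norm_mul, Complex.norm_real, Complex.norm_exp, Complex.re_mul_ofReal]
      have h1 := hG0 i _ (hcl0 z.1)
      have h2 := hGρ i _ (hcl0 z.1) (hclT z.1)
      rw [Real.norm_of_nonneg (by linarith)]
      have : Real.exp ((κ i z.2).re * cl z.1) ≤ 1 := by
        rw [Real.exp_le_one_iff]
        exact mul_nonpos_of_nonpos_of_nonneg (hκ0 _ _) (hcl0 _)
      exact mul_le_one₀ (by linarith) (Real.exp_nonneg _) this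
    · refine (aux_conv_bound (g i) (hg i) (hg0 i) (κ i z.2) (hκ0 i z.2) _ ‖u‖ _ (hcl0 _)
        (fun w _ _ => (hsum i _).trans (u.norm_coe_le_norm _))).trans ?_
      rw [← hG]
      exact mul_le_mul_of_nonneg_right (hGρ i _ (hcl0 _) (hclT _)) (norm_nonneg _)
  let Φ : BoundedContinuousFunction (ℝ × ℝ) (Fin k → ℂ) →
      BoundedContinuousFunction (ℝ × ℝ) (Fin k → ℂ) := fun u =>
    BoundedContinuousFunction.ofNormedAddCommGroup (Φ0 u) (hΦc u u.continuous) _ (hΦb u)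
  have hcontr : ContractingWith ⟨ρ, hρ0⟩ Φ := by
    refine ⟨by exact_mod_cast hρ1, LipschitzWith.of_dist_le_mul fun u v => ?_⟩
    rw [dist_eq_norm, dist_eq_norm]
    refine (BoundedContinuousFunction.norm_le (by positivity)).2 fun z => ?_
    refine (pi_norm_le_iff_of_nonneg (by positivity)).2 fun i => ?_
    have hIntg : ∀ u : BoundedContinuousFunction (ℝ × ℝ) (Fin k → ℂ), IntervalIntegrable
        (fun w => (g i (cl z.1 - w) : ℂ) *
          Complex.exp (κ i z.2 * ((cl z.1 - w : ℝ) : ℂ)) * ∑ j, (p i j : ℂ) * u (w, z.2) j)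
          volume 0 (cl z.1) := by
      intro u
      have := hg i
      exact (by fun_prop : Continuous _).intervalIntegrable _ _
    have e : (Φ u - Φ v) z i = ∫ w in (0:ℝ)..(cl z.1), (g i (cl z.1 - w) : ℂ) *
          Complex.exp (κ i z.2 * ((cl z.1 - w : ℝ) : ℂ)) * ∑ j, (p i j : ℂ) * (u - v) (w, z.2) j := by
      change Φ0 u z i - Φ0 v z i = _
      simp only [Φ0]
      rw [add_sub_add_left_eq_sub, ← intervalIntegral.integral_sub (hIntg u) (hIntg v)]
      congr 1
      funext w
      rw [← mul_sub, ← Finset.sum_sub_distrib]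
      congr 2
      funext j
      simp [mul_sub]
    rw [e]
    refine (aux_conv_bound (g i) (hg i) (hg0 i) (κ i z.2) (hκ0 i z.2) _ ‖u - v‖ _ (hcl0 _)
        (fun w _ _ => (hsum i _).trans ((u - v).norm_coe_le_norm _))).trans ?_
    rw [← hG]
    exact mul_le_mul_of_nonneg_right (hGρ i _ (hcl0 _) (hclT _)) (norm_nonneg _)
  set u := ContractingWith.fixedPoint Φ hcontr with hu
  have hfix : Φ u = u := hcontr.fixedPoint_isFixedPt
  refine ⟨fun i τ ω => u (τ, ω) i, fun i => ?_, ⟨‖u‖, fun i τ ω => ?_⟩, fun i τ ω h1 h2 => ?_⟩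
  · exact (continuous_apply i).comp u.continuous
  · exact (norm_le_pi_norm _ i).trans (u.norm_coe_le_norm _)
  · have : Φ0 u (τ, ω) i = u (τ, ω) i := congrFun (congrArg (fun v => v (τ, ω)) hfix) i
    refine this.symm.trans ?_
    simp only [Φ0, hcle τ h1 h2]

lemma aux_volterra {k : ℕ} (T : ℝ) (hT : 0 < T) (p : Fin k → Fin k → ℝ)
    (hp0 : ∀ i j, 0 ≤ p i j) (hp1 : ∀ i, ∑ j, p i j = 1)
    (g : Fin k → ℝ → ℝ) (hg : ∀ i, Continuous (g i)) (hg0 : ∀ i x, 0 ≤ x → 0 ≤ g i x)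
    (G : Fin k → ℝ → ℝ) (hG : ∀ i y, G i y = ∫ u in (0:ℝ)..y, g i u)
    (ρ : ℝ) (hρ0 : 0 ≤ ρ) (hρ1 : ρ < 1) (hGρ : ∀ i τ, 0 ≤ τ → τ ≤ T → G i τ ≤ ρ)
    (κ : Fin k → ℝ → ℂ) (hκ : ∀ i, Continuous (κ i)) (c : ℝ → ℝ) (hc : Continuous c)
    (hκ0 : ∀ i ω, (κ i ω).re ≤ - c ω) :
    ∃ N : Fin k → ℝ → ℝ → ℂ, (∀ i, Continuous (fun z : ℝ × ℝ => N i z.1 z.2)) ∧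
      (∃ C, ∀ i τ ω, ‖N i τ ω‖ ≤ C * Real.exp (- c ω * τ)) ∧
      ∀ i τ ω, 0 ≤ τ → τ ≤ T → N i τ ω = ((1 - G i τ : ℝ) : ℂ) * Complex.exp (κ i ω * τ) +
        ∫ w in (0:ℝ)..τ, (g i (τ - w) : ℂ) * Complex.exp (κ i ω * ((τ - w : ℝ) : ℂ)) *
          ∑ j, (p i j : ℂ) * N j w ω := by
  obtain ⟨N, hNc, ⟨C, hC⟩, hN⟩ := aux_volterra_fix T hT p hp0 hp1 g hg hg0 G hG ρ hρ0 hρ1 hGρ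
    (fun i ω => κ i ω + (c ω : ℂ)) (fun i => by have := hκ i; fun_prop)
    (fun i ω => by simp; linarith [hκ0 i ω])
  refine ⟨fun i τ ω => Complex.exp (-(c ω : ℂ) * τ) * N i τ ω, fun i => ?_, ⟨C, fun i τ ω => ?_⟩,
    fun i τ ω h1 h2 => ?_⟩
  · have := hNc i
    fun_prop
  · rw [norm_mul, Complex.norm_exp]
    have : (-(c ω : ℂ) * τ).re = - c ω * τ := by
      rw [← Complex.ofReal_neg, Complex.re_ofReal_mul]; simp
    rw [this, mul_comm]
    exact mul_le_mul_of_nonneg_right (hC i τ ω) (Real.exp_nonneg _)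
  · simp only
    rw [hN i τ ω h1 h2, mul_add, ← intervalIntegral.integral_const_mul]
    congr 1
    · rw [mul_left_comm, ← Complex.exp_add]
      congr 2; ring
    · congr 1
      funext w
      have e1 : ∑ j, (p i j : ℂ) * (Complex.exp (-(c ω : ℂ) * w) * N j w ω)
          = Complex.exp (-(c ω : ℂ) * w) * ∑ j, (p i j : ℂ) * N j w ω := by
        rw [Finset.mul_sum]; congr 1; funext j; ring
      have e2 : Complex.exp (κ i ω * ((τ - w : ℝ) : ℂ)) * Complex.exp (-(c ω : ℂ) * w)
          = Complex.exp (-(c ω : ℂ) * τ) * Complex.exp ((κ i ω + (c ω : ℂ)) * ((τ - w : ℝ) : ℂ)) := by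
        rw [← Complex.exp_add, ← Complex.exp_add]; congr 1; push_cast; ring
      rw [e1]
      linear_combination (-(g i (τ - w) : ℂ) * ∑ j, (p i j : ℂ) * N j w ω) * e2
lemma aux_closure (T : ℝ) (hT : 0 < T) : domDbar T ⊆ closure (domD T) := by
  intro q hq
  obtain ⟨h1, h2, h3, h4, h5⟩ := hq
  have hc : Filter.Tendsto (fun θ : ℝ => ((1 - θ) * q.1 + θ * (T / 2), (1 - θ) * q.2.1 + θ * 1,
      (1 - θ) * q.2.2 + θ * (T / 4))) (nhdsWithin 0 (Set.Ioi 0)) (nhds q) := by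
    have : Continuous (fun θ : ℝ => ((1 - θ) * q.1 + θ * (T / 2), (1 - θ) * q.2.1 + θ * 1,
      (1 - θ) * q.2.2 + θ * (T / 4))) := by fun_prop
    have h := this.tendsto 0
    simp only [sub_zero, one_mul, zero_mul, add_zero] at h
    exact h.mono_left nhdsWithin_le_nhds
  refine mem_closure_of_tendsto hc ?_
  have : Set.Ioo (0:ℝ) 1 ∈ nhdsWithin (0:ℝ) (Set.Ioi 0) := Ioo_mem_nhdsGT one_pos
  filter_upwards [this] with θ hθ
  obtain ⟨a, b⟩ := hθ
  have b' : 0 < 1 - θ := by linarith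
  refine ⟨?_, ?_, ?_, ?_, ?_⟩ <;> simp only <;> nlinarith [mul_nonneg b'.le h1, mul_nonneg b'.le h3, mul_nonneg b'.le h4,
    mul_le_mul_of_nonneg_left h2 b'.le, mul_le_mul_of_nonneg_left h5 b'.le, mul_pos a hT]

lemma aux_le_closure (T : ℝ) (hT : 0 < T) (w : ℝ × ℝ × ℝ → ℝ) (hw : ContinuousOn w (domDbar T))
    (S : ℝ) (hS : ∀ q ∈ domD T, w q ≤ S) (q : ℝ × ℝ × ℝ) (hq : q ∈ domDbar T) : w q ≤ S := by
  have hsub : domD T ⊆ domDbar T := fun q hq =>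
    ⟨hq.1.le, hq.2.1.le, hq.2.2.1.le, hq.2.2.2.1.le, hq.2.2.2.2.le⟩
  have h1 : Filter.Tendsto w (nhdsWithin q (domD T)) (nhds (w q)) :=
    ((hw q hq).mono hsub)
  have : (nhdsWithin q (domD T)).NeBot := mem_closure_iff_nhdsWithin_neBot.1 (aux_closure T hT hq)
  refine le_of_tendsto h1 ?_
  filter_upwards [self_mem_nhdsWithin] with z hz using hS z hz

lemma aux_open (T : ℝ) : IsOpen (domD T) := by
  have h1 : IsOpen {q : ℝ × ℝ × ℝ | 0 < q.1} := isOpen_lt (by fun_prop) (by fun_prop)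
  have h2 : IsOpen {q : ℝ × ℝ × ℝ | q.1 < T} := isOpen_lt (by fun_prop) (by fun_prop)
  have h3 : IsOpen {q : ℝ × ℝ × ℝ | 0 < q.2.1} := isOpen_lt (by fun_prop) (by fun_prop)
  have h4 : IsOpen {q : ℝ × ℝ × ℝ | 0 < q.2.2} := isOpen_lt (by fun_prop) (by fun_prop)
  have h5 : IsOpen {q : ℝ × ℝ × ℝ | q.2.2 < q.1} := isOpen_lt (by fun_prop) (by fun_prop)
  exact h1.inter (h2.inter (h3.inter (h4.inter h5)))

lemma aux_clK (T R η : ℝ) : IsClosed {q : ℝ × ℝ × ℝ | q.1 ≤ T ∧ 0 ≤ q.2.1 ∧ q.2.1 ≤ R ∧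
    η ≤ q.2.2 ∧ η ≤ q.1 - q.2.2} := by
  have h1 : IsClosed {q : ℝ × ℝ × ℝ | q.1 ≤ T} := isClosed_le (by fun_prop) (by fun_prop)
  have h2 : IsClosed {q : ℝ × ℝ × ℝ | 0 ≤ q.2.1} := isClosed_le (by fun_prop) (by fun_prop)
  have h3 : IsClosed {q : ℝ × ℝ × ℝ | q.2.1 ≤ R} := isClosed_le (by fun_prop) (by fun_prop)
  have h4 : IsClosed {q : ℝ × ℝ × ℝ | η ≤ q.2.2} := isClosed_le (by fun_prop) (by fun_prop)
  have h5 : IsClosed {q : ℝ × ℝ × ℝ | η ≤ q.1 - q.2.2} := isClosed_le (by fun_prop) (by fun_prop)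
  exact h1.inter (h2.inter (h3.inter (h4.inter h5)))

set_option maxHeartbeats 1000000 in
/-- Maximum principle for the homogeneous problem. -/
lemma aux_max {k : ℕ} (T : ℝ) (hT : 0 < T)
    (r σ : Fin k → ℝ) (hr : ∀ i, 0 ≤ r i)
    (p : Fin k → Fin k → ℝ) (hp0 : ∀ i j, 0 ≤ p i j)
    (hp1 : ∀ i, ∑ j, p i j = 1)
    (h : Fin k → ℝ → ℝ) (H : ℝ) (hh0 : ∀ i y, 0 < y → y < T → 0 ≤ h i y)
    (hhH : ∀ i y, 0 < y → y < T → h i y ≤ H) (hH : 0 ≤ H)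
    (d : ℝ → ℝ → Fin k → ℝ → ℝ) (hcont : ContOnClosure T d) (hlin : LinGrowth T d)
    (hd0 : ∀ t y : ℝ, ∀ i, 0 ≤ t → t ≤ T → 0 ≤ y → y ≤ t → d t 0 i y = 0)
    (hdT : ∀ s : ℝ, 0 < s → ∀ y : ℝ, 0 ≤ y → y ≤ T → ∀ i, d T s i y = 0)
    (Dt Ds Dss Dy : ℝ → ℝ → Fin k → ℝ → ℝ)
    (hD : ∀ t s y : ℝ, (t, s, y) ∈ domD T → ∀ i,
      HasDerivAt (fun τ => d τ s i y) (Dt t s i y) t ∧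
      HasDerivAt (fun w => d t w i y) (Ds t s i y) s ∧
      HasDerivAt (fun w => Ds t w i y) (Dss t s i y) s ∧
      HasDerivAt (fun u => d t s i u) (Dy t s i y) y ∧
      Dt t s i y + Dy t s i y + r i * s * Ds t s i y
        + (1 / 2) * (σ i) ^ 2 * s ^ 2 * Dss t s i y
        + h i y *
            ∑ j ∈ Finset.univ.erase i, p i j * (d t s j 0 - d t s i y)
        = r i * d t s i y) :
    ∀ t s y : ℝ, (t, s, y) ∈ domD T → ∀ i, d t s i y ≤ 0 := by
  intro t0 s0 y0 hq0 i0
  by_contra hpos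
  push Not at hpos
  obtain ⟨C, hC⟩ := hlin
  have hCnn : 0 ≤ |C| := abs_nonneg C
  set L : ℝ := ∑ i, (r i + (σ i)^2) + H + 1 with hL
  have hLi : ∀ i, r i + (σ i)^2 + H < L := by
    intro i
    have : r i + (σ i)^2 ≤ ∑ i, (r i + (σ i)^2) :=
      Finset.single_le_sum (f := fun i => r i + (σ i)^2)
        (fun j _ => add_nonneg (hr j) (sq_nonneg _)) (Finset.mem_univ i)
    linarith
  have hL0 : 0 < L := by
    have := hLi i0
    have := hr i0
    have := sq_nonneg (σ i0)
    linarith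
  set w : Fin k → ℝ × ℝ × ℝ → ℝ := fun i q => Real.exp (L * q.1) * d q.1 q.2.1 i q.2.2 / (1 + q.2.1^2) with hw
  have hwc : ∀ i, ContinuousOn (w i) (domDbar T) := by
    intro i
    have := hcont i
    refine ContinuousOn.div (ContinuousOn.mul (by fun_prop) this) (by fun_prop) ?_
    intro q _
    positivity
  have hwb : ∀ i, ∀ q ∈ domD T, w i q ≤ Real.exp (L * T) * |C| * (1 + q.2.1) / (1 + q.2.1^2) := by
    intro i q hq
    obtain ⟨a1, a2, a3, a4, a5⟩ := id hq
    have h1 := (le_abs_self _).trans (hC q.1 q.2.1 q.2.2 hq i)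
    have h2 : d q.1 q.2.1 i q.2.2 ≤ |C| * (1 + q.2.1) :=
      h1.trans (mul_le_mul_of_nonneg_right (le_abs_self C) (by linarith))
    have h3 : Real.exp (L * q.1) ≤ Real.exp (L * T) := by
      apply Real.exp_le_exp.2; gcongr
    simp only [hw]
    rw [div_le_div_iff_of_pos_right (by positivity), mul_assoc]
    calc _ ≤ Real.exp (L * q.1) * (|C| * (1 + q.2.1)) := by gcongr
      _ ≤ _ := by gcongr
  set A : Set ℝ := {x | ∃ i, ∃ q ∈ domD T, x = w i q} with hA
  have hAb : BddAbove A := by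
    refine ⟨Real.exp (L * T) * |C| * 2, ?_⟩
    rintro x ⟨i, q, hq, rfl⟩
    refine (hwb i q hq).trans ?_
    rw [div_le_iff₀ (by positivity), mul_assoc (Real.exp (L*T) * |C|)]
    refine mul_le_mul_of_nonneg_left ?_ (by positivity)
    nlinarith [sq_nonneg (q.2.1 - 1)]
  set S := sSup A with hS
  have hwS : ∀ i, ∀ q ∈ domD T, w i q ≤ S := fun i q hq => le_csSup hAb ⟨i, q, hq, rfl⟩
  have hwS' : ∀ i, ∀ q ∈ domDbar T, w i q ≤ S := fun i q hq =>
    aux_le_closure T hT (w i) (hwc i) S (hwS i) q hq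
  have hSpos : 0 < S := by
    refine lt_of_lt_of_le ?_ (hwS i0 _ hq0)
    simp only [hw]
    positivity
  obtain ⟨x, ⟨i, q1, hq1, rfl⟩, hx⟩ := exists_lt_of_lt_csSup (⟨_, i0, _, hq0, rfl⟩ : A.Nonempty)
    (show 3 / 4 * S < sSup A by linarith)
  set B : ℝ × ℝ × ℝ → ℝ := fun q => 1 / q.2.2 + 1 / (q.1 - q.2.2) with hB
  have hB1 : 0 < B q1 := by
    obtain ⟨a1, a2, a3, a4, a5⟩ := id hq1
    have : 0 < q1.1 - q1.2.2 := by linarith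
    simp only [hB]
    positivity
  set ε : ℝ := S / (8 * B q1) with hε
  have hε0 : 0 < ε := by positivity
  have hεB : ε * B q1 = S / 8 := by rw [hε]; field_simp
  set η : ℝ := 2 * ε / S with hη
  have hη0 : 0 < η := by positivity
  set R : ℝ := 1 + 4 * (Real.exp (L * T) * |C|) / S with hR
  have hR1 : 1 ≤ R := by
    have : 0 ≤ 4 * (Real.exp (L * T) * |C|) / S := by positivity
    linarith
  set Kc : Set (ℝ × ℝ × ℝ) := {q | q.1 ≤ T ∧ 0 ≤ q.2.1 ∧ q.2.1 ≤ R ∧ η ≤ q.2.2 ∧ η ≤ q.1 - q.2.2} with hKc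
  have hKbar : Kc ⊆ domDbar T := by
    rintro q ⟨a1, a2, a3, a4, a5⟩
    refine ⟨?_, a1, a2, ?_, ?_⟩ <;> linarith
  have hKcomp : IsCompact Kc := by
    have hbox : IsCompact (Set.Icc (0:ℝ) T ×ˢ Set.Icc (0:ℝ) R ×ˢ Set.Icc (0:ℝ) T) :=
      isCompact_Icc.prod (isCompact_Icc.prod isCompact_Icc)
    refine hbox.of_isClosed_subset ?_ ?_
    · exact aux_clK T R η
    · rintro q ⟨a1, a2, a3, a4, a5⟩
      exact ⟨⟨by linarith, a1⟩, ⟨a2, a3⟩, ⟨by linarith, by linarith⟩⟩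
  -- points outside of the compact set have small values
  have hout : ∀ q ∈ domD T, S / 2 ≤ w i q - ε * B q → q ∈ Kc := by
    intro q hq hge
    obtain ⟨a1, a2, a3, a4, a5⟩ := id hq
    have a6 : 0 < q.1 - q.2.2 := by linarith
    have b1 := hwS i q hq
    have b2 : ε * B q ≤ S / 2 := by linarith
    have b3 : 0 < 1 / q.2.2 := by positivity
    have b4 : 0 < 1 / (q.1 - q.2.2) := by positivity
    have b5 : ε * (1 / q.2.2) ≤ S / 2 := by
      refine le_trans ?_ b2
      simp only [hB]
      exact mul_le_mul_of_nonneg_left (by linarith) hε0.le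
    have b6 : ε * (1 / (q.1 - q.2.2)) ≤ S / 2 := by
      refine le_trans ?_ b2
      simp only [hB]
      exact mul_le_mul_of_nonneg_left (by linarith) hε0.le
    refine ⟨a2.le, a3.le, ?_, ?_, ?_⟩
    · by_contra hlt
      push Not at hlt
      have c1 := hwb i q hq
      have c2 : S / 2 ≤ Real.exp (L * T) * |C| * (1 + q.2.1) / (1 + q.2.1^2) := by
        have : 0 < ε * B q := mul_pos hε0 (by simp only [hB]; linarith)
        linarith
      rw [le_div_iff₀ (by positivity)] at c2
      set E := Real.exp (L * T) * |C| with hE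
      have hE0 : 0 ≤ E := by positivity
      have c3 : 4 * E < (q.2.1 - 1) * S := by
        rw [hR] at hlt
        have : 4 * E / S < q.2.1 - 1 := by linarith
        rwa [div_lt_iff₀ hSpos] at this
      have c4 : 1 < q.2.1 := by linarith
      nlinarith [mul_pos (sub_pos.2 c4) hSpos, mul_pos a3 hSpos]
    · rw [hη, div_le_iff₀ hSpos]
      rw [mul_one_div, div_le_iff₀ a4] at b5
      linarith
    · rw [hη, div_le_iff₀ hSpos]
      rw [mul_one_div, div_le_iff₀ a6] at b6
      linarith
  have hv1 : S / 2 ≤ w i q1 - ε * B q1 := by linarith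
  have hq1K : q1 ∈ Kc := hout q1 hq1 hv1
  have hBc : ContinuousOn B Kc := by
    refine ContinuousOn.add ?_ ?_
    · refine ContinuousOn.div (by fun_prop) (by fun_prop) ?_
      intro q hq
      exact (lt_of_lt_of_le hη0 hq.2.2.2.1).ne'
    · refine ContinuousOn.div (by fun_prop) (by fun_prop) ?_
      intro q hq
      exact (lt_of_lt_of_le hη0 hq.2.2.2.2).ne'
  obtain ⟨⟨t, s, y⟩, hQK, hQmax⟩ := hKcomp.exists_isMaxOn ⟨q1, hq1K⟩
    (((hwc i).mono hKbar).sub (hBc.const_smul ε))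
  have hQv : S / 2 ≤ w i (t, s, y) - ε * B (t, s, y) := hv1.trans (hQmax hq1K)
  have hQbar := hKbar hQK
  obtain ⟨k1, k2, k3, k4, k5⟩ := hQK
  simp only at k1 k2 k3 k4 k5
  have hy : 0 < y := by linarith
  have hty : 0 < t - y := by linarith
  have hBQ : 0 < ε * B (t, s, y) := by
    refine mul_pos hε0 ?_
    simp only [hB]
    positivity
  have hwQ : S / 2 < w i (t, s, y) := by linarith
  have hdpos : 0 < d t s i y := by
    have : 0 < w i (t, s, y) := by linarith
    simp only [hw] at this
    by_contra hneg
    push Not at hneg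
    have : Real.exp (L * t) * d t s i y / (1 + s^2) ≤ 0 :=
      div_nonpos_of_nonpos_of_nonneg (mul_nonpos_of_nonneg_of_nonpos (Real.exp_nonneg _) hneg)
        (by positivity)
    linarith
  have hs : 0 < s := by
    rcases k2.lt_or_eq with h1 | h1
    · exact h1
    · rw [← h1, hd0 t y i (by linarith) k1 hy.le (by linarith)] at hdpos
      exact absurd hdpos (lt_irrefl _)
  have htT : t < T := by
    rcases k1.lt_or_eq with h1 | h1
    · exact h1
    · rw [h1, hdT s hs y hy.le (by linarith)] at hdpos
      exact absurd hdpos (lt_irrefl _)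
  have hQ : (t, s, y) ∈ domD T := ⟨by simp only; linarith, htT, hs, hy, by simp only; linarith⟩
  have hmax : ∀ q ∈ domD T, w i q - ε * B q ≤ w i (t, s, y) - ε * B (t, s, y) := by
    intro q hq
    by_cases hc : S / 2 ≤ w i q - ε * B q
    · exact hQmax (hout q hq hc)
    · linarith
  obtain ⟨d1, d2, d3, d4, hpde⟩ := hD t s y hQ i
  have hopen : IsOpen (domD T) := aux_open T
  have hnt : ∀ᶠ τ in nhds t, (τ, s, y) ∈ domD T :=
    (by fun_prop : Continuous fun τ : ℝ => (τ, s, y)).continuousAt.eventually (hopen.mem_nhds hQ)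
  have hns : ∀ᶠ z in nhds s, (t, z, y) ∈ domD T :=
    (by fun_prop : Continuous fun z : ℝ => (t, z, y)).continuousAt.eventually (hopen.mem_nhds hQ)
  have hny : ∀ᶠ z in nhds y, (t, s, z) ∈ domD T :=
    (by fun_prop : Continuous fun z : ℝ => (t, s, z)).continuousAt.eventually (hopen.mem_nhds hQ)
  -- derivative in t
  have et : (Real.exp (L * t) * L * d t s i y + Real.exp (L * t) * Dt t s i y) / (1 + s^2)
      - ε * (0 + (-1) / (t - y)^2) = 0 := by
    have hloc : IsLocalMax (fun τ => w i (τ, s, y) - ε * B (τ, s, y)) t :=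
      hnt.mono fun τ hτ => hmax _ hτ
    refine hloc.hasDerivAt_eq_zero ?_
    have e1 : HasDerivAt (fun τ => Real.exp (L * τ)) (Real.exp (L * t) * L) t := by
      simpa using ((hasDerivAt_id t).const_mul L).exp
    simp only [hw, hB]
    refine HasDerivAt.fun_sub (HasDerivAt.div_const (HasDerivAt.fun_mul e1 d1) _)
      (HasDerivAt.const_mul ε ?_)
    refine HasDerivAt.fun_add (hasDerivAt_const t _) ?_
    have := HasDerivAt.fun_inv ((hasDerivAt_id' t).sub_const y) hty.ne'
    simpa [one_div] using this
  have ey : (Real.exp (L * t) * Dy t s i y) / (1 + s^2)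
      - ε * ((-1) / y^2 + 1 / (t - y)^2) = 0 := by
    have hloc : IsLocalMax (fun z => w i (t, s, z) - ε * B (t, s, z)) y :=
      hny.mono fun τ hτ => hmax _ hτ
    refine hloc.hasDerivAt_eq_zero ?_
    simp only [hw, hB]
    refine HasDerivAt.fun_sub (HasDerivAt.div_const (HasDerivAt.const_mul _ d4) _)
      (HasDerivAt.const_mul ε ?_)
    refine HasDerivAt.fun_add ?_ ?_
    · have := HasDerivAt.fun_inv (hasDerivAt_id' y) hy.ne'
      exact this.congr_of_eventuallyEq (Filter.Eventually.of_forall fun z => one_div z)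
    · have := HasDerivAt.fun_inv ((hasDerivAt_id' y).const_sub t) hty.ne'
      simpa [one_div] using this
  have hsum : Dt t s i y + Dy t s i y < - L * d t s i y := by
    have e1 : Real.exp (L * t) / (1 + s^2) * (L * d t s i y + Dt t s i y + Dy t s i y) = - (ε / y^2) := by
      linear_combination et + ey
    have e2 : 0 < Real.exp (L * t) / (1 + s^2) := by positivity
    have e3 : 0 < ε / y^2 := by positivity
    by_contra hcon
    push Not at hcon
    have : 0 ≤ Real.exp (L * t) / (1 + s^2) * (L * d t s i y + Dt t s i y + Dy t s i y) :=
      mul_nonneg e2.le (by linarith)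
    linarith
  -- derivatives in s
  set κ : ℝ := d t s i y / (1 + s^2) with hκ
  have hκ0 : 0 < κ := by positivity
  have hκd : κ * (1 + s^2) = d t s i y := by rw [hκ]; field_simp
  obtain ⟨es1, es2⟩ := aux_second (fun z => d t z i y - κ * (1 + z^2)) (fun z => Ds t z i y - κ * (2 * z)) s
    (Dss t s i y - κ * 2)
    (hns.mono fun z hz => by
      refine ((hD t z y hz i).2.1).sub (HasDerivAt.const_mul κ ?_)
      simpa using (hasDerivAt_pow 2 z).const_add 1)
    (by
      refine d3.sub (HasDerivAt.const_mul κ ?_)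
      simpa using (hasDerivAt_id s).const_mul 2)
    (hns.mono fun z hz => by
      have h1 := hmax _ hz
      simp only [hw, hB] at h1
      have h2 : Real.exp (L * t) * d t z i y / (1 + z^2) ≤ Real.exp (L * t) * d t s i y / (1 + s^2) := by
        linarith
      rw [mul_div_assoc, mul_div_assoc] at h2
      have h3 : d t z i y / (1 + z^2) ≤ κ := le_of_mul_le_mul_left h2 (Real.exp_pos _)
      rw [div_le_iff₀ (by positivity)] at h3
      simp only
      linarith)
  -- nonlocal term
  have hnl : ∀ j, d t s j 0 - d t s i y ≤ d t s i y := by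
    intro j
    have h1 := hwS' j (t, s, 0) ⟨by simp only; linarith, k1, k2, le_rfl, by simp only; linarith⟩
    have h2 : w j (t, s, 0) ≤ 2 * w i (t, s, y) := by linarith
    simp only [hw] at h2
    have h3 : Real.exp (L * t) * d t s j 0 / (1 + s^2) ≤ Real.exp (L * t) * (2 * d t s i y) / (1 + s^2) := by
      refine h2.trans (le_of_eq ?_); ring
    rw [div_le_div_iff_of_pos_right (by positivity)] at h3
    have h4 := le_of_mul_le_mul_left h3 (Real.exp_pos _)
    linarith
  have hnl2 : ∑ j ∈ Finset.univ.erase i, p i j * (d t s j 0 - d t s i y) ≤ d t s i y := by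
    calc _ ≤ ∑ j ∈ Finset.univ.erase i, p i j * d t s i y :=
          Finset.sum_le_sum fun j _ => mul_le_mul_of_nonneg_left (hnl j) (hp0 i j)
      _ ≤ ∑ j, p i j * d t s i y :=
          Finset.sum_le_sum_of_subset_of_nonneg (Finset.subset_univ _)
            fun j _ _ => mul_nonneg (hp0 i j) hdpos.le
      _ = d t s i y := by rw [← Finset.sum_mul, hp1, one_mul]
  have hyT : y < T := by linarith
  have hnl3 : h i y * ∑ j ∈ Finset.univ.erase i, p i j * (d t s j 0 - d t s i y) ≤ H * d t s i y := by
    calc _ ≤ h i y * d t s i y := mul_le_mul_of_nonneg_left hnl2 (hh0 i y hy hyT)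
      _ ≤ _ := mul_le_mul_of_nonneg_right (hhH i y hy hyT) hdpos.le
  have hDs : Ds t s i y = κ * (2 * s) := by linarith
  have hDss : (1 / 2) * (σ i) ^ 2 * s ^ 2 * Dss t s i y ≤ (1 / 2) * (σ i) ^ 2 * s ^ 2 * (κ * 2) :=
    mul_le_mul_of_nonneg_left (by linarith) (by positivity)
  have hks : κ * s^2 ≤ d t s i y := by nlinarith
  have t1 : r i * s * Ds t s i y ≤ 2 * r i * d t s i y := by
    have h1 := mul_le_mul_of_nonneg_left hks (hr i)
    have h2 : r i * s * Ds t s i y = 2 * (r i * (κ * s^2)) := by rw [hDs]; ring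
    linarith
  have t2 : (1 / 2) * (σ i) ^ 2 * s ^ 2 * Dss t s i y ≤ (σ i)^2 * d t s i y := by
    have h1 := mul_le_mul_of_nonneg_left hks (sq_nonneg (σ i))
    have h2 : (1 / 2) * (σ i) ^ 2 * s ^ 2 * (κ * 2) = (σ i)^2 * (κ * s^2) := by ring
    linarith
  have h9 := mul_lt_mul_of_pos_right (hLi i) hdpos
  have h10 : (r i + (σ i)^2 + H) * d t s i y = r i * d t s i y + (σ i)^2 * d t s i y + H * d t s i y := by
    ring
  linarith

/-- Uniqueness of classical solutions of at most linear growth. -/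
lemma aux_unique {k : ℕ} (T K : ℝ) (hT : 0 < T)
    (r σ : Fin k → ℝ) (hr : ∀ i, 0 ≤ r i)
    (p : Fin k → Fin k → ℝ) (hp0 : ∀ i j, 0 ≤ p i j)
    (hp1 : ∀ i, ∑ j, p i j = 1)
    (f F : Fin k → ℝ → ℝ) (H : ℝ) (hh0 : ∀ i y, 0 < y → y < T → 0 ≤ f i y / (1 - F i y))
    (hhH : ∀ i y, 0 < y → y < T → f i y / (1 - F i y) ≤ H) (hH : 0 ≤ H)
    (φ ψ : ℝ → ℝ → Fin k → ℝ → ℝ)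
    (hφ : IsClassicalSol r σ p f F K T φ) (hφl : LinGrowth T φ)
    (hψ : IsClassicalSol r σ p f F K T ψ) (hψl : LinGrowth T ψ) :
    ∀ t s y : ℝ, (t, s, y) ∈ domDbar T → ∀ i, ψ t s i y - φ t s i y ≤ 0 := by
  obtain ⟨c1, b1, e1, Dt1, Ds1, Dss1, Dy1, hD1, -⟩ := hφ
  obtain ⟨c2, b2, e2, Dt2, Ds2, Dss2, Dy2, hD2, -⟩ := hψ
  obtain ⟨C1, hC1⟩ := hφl
  obtain ⟨C2, hC2⟩ := hψl
  have hc : ContOnClosure T (fun t s i y => ψ t s i y - φ t s i y) := fun i => (c2 i).sub (c1 i)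
  have key := aux_max T hT r σ hr p hp0 hp1 (fun i y => f i y / (1 - F i y)) H hh0 hhH hH
    (fun t s i y => ψ t s i y - φ t s i y) hc
    ⟨C2 + C1, fun t s y hq i => by
      have := abs_sub (ψ t s i y) (φ t s i y)
      have a1 := hC1 t s y hq i
      have a2 := hC2 t s y hq i
      linarith⟩
    (fun t y i h1 h2 h3 h4 => by simp [b1 t y i h1 h2 h3 h4, b2 t y i h1 h2 h3 h4])
    (fun s hs y h1 h2 i => by simp [e1 s hs y h1 h2 i, e2 s hs y h1 h2 i])
    (fun t s i y => Dt2 t s i y - Dt1 t s i y) (fun t s i y => Ds2 t s i y - Ds1 t s i y)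
    (fun t s i y => Dss2 t s i y - Dss1 t s i y) (fun t s i y => Dy2 t s i y - Dy1 t s i y)
    (fun t s y hq i => by
      obtain ⟨u1, u2, u3, u4, u5⟩ := hD1 t s y hq i
      obtain ⟨v1, v2, v3, v4, v5⟩ := hD2 t s y hq i
      refine ⟨v1.sub u1, v2.sub u2, v3.sub u3, v4.sub u4, ?_⟩
      have e : ∑ j ∈ Finset.univ.erase i, p i j * (ψ t s j 0 - φ t s j 0 - (ψ t s i y - φ t s i y))
          = ∑ j ∈ Finset.univ.erase i, p i j * (ψ t s j 0 - ψ t s i y)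
            - ∑ j ∈ Finset.univ.erase i, p i j * (φ t s j 0 - φ t s i y) := by
        rw [← Finset.sum_sub_distrib]
        refine Finset.sum_congr rfl fun j _ => ?_
        ring
      simp only [e]
      linear_combination v5 - u5)
  intro t s y hq i
  exact aux_le_closure T hT (fun q => ψ q.1 q.2.1 i q.2.2 - φ q.1 q.2.1 i q.2.2) (hc i) 0
    (fun q hq => key _ _ _ hq i) (t, s, y) hq
/-- Properties of a single Fourier mode (before normalisation). -/
lemma aux_modes (g g' G : ℝ → ℝ) (hg : ∀ x, HasDerivAt g (g' x) x) (hg' : Continuous g')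
    (hG : ∀ x, HasDerivAt G (g x) x) (κ : ℝ → ℂ) (hκ : Continuous κ) (n : ℝ → ℝ → ℂ)
    (hn : Continuous (fun z : ℝ × ℝ => n z.1 z.2)) (T B C : ℝ) (hT : 0 < T) (c : ℝ → ℝ)
    (hgB : ∀ x, 0 ≤ x → x ≤ T → |g x| ≤ B) (hg'B : ∀ x, 0 ≤ x → x ≤ T → |g' x| ≤ B)
    (hGB : ∀ x, 0 ≤ x → x ≤ T → |1 - G x| ≤ B)
    (hκc : ∀ ω, (κ ω).re ≤ - c ω) (hnC : ∀ w ω, ‖n w ω‖ ≤ C * Real.exp (- c ω * w)) :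
    ∃ P Py : ℝ → ℝ → ℝ → ℂ,
      Continuous (fun z : ℝ × ℝ × ℝ => P z.1 z.2.1 z.2.2) ∧
      Continuous (fun z : ℝ × ℝ × ℝ => Py z.1 z.2.1 z.2.2) ∧
      (∀ τ y ω, HasDerivAt (fun y => P τ y ω) (Py τ y ω) y) ∧
      (∀ τ y ω, HasDerivAt (fun τ => P τ y ω)
        (κ ω * P τ y ω + Py τ y ω + (g y : ℂ) * n τ ω) τ) ∧
      (∀ y ω, P 0 y ω = ((1 - G y : ℝ) : ℂ)) ∧
      (∀ τ ω, P τ 0 ω = ((1 - G τ : ℝ) : ℂ) * Complex.exp (κ ω * τ) +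
        ∫ w in (0:ℝ)..τ, (g (τ - w) : ℂ) * Complex.exp (κ ω * ((τ - w : ℝ) : ℂ)) * n w ω) ∧
      (∃ C', ∀ τ y ω, 0 ≤ τ → 0 ≤ y → τ + y ≤ T → ‖P τ y ω‖ ≤ C' * Real.exp (- c ω * τ)) ∧
      (∃ C', ∀ τ y ω, 0 ≤ τ → 0 ≤ y → τ + y ≤ T → ‖Py τ y ω‖ ≤ C' * Real.exp (- c ω * τ)) := by
  have hgc : Continuous g := continuous_iff_continuousAt.2 fun x => (hg x).continuousAt
  have hGc : Continuous G := continuous_iff_continuousAt.2 fun x => (hG x).continuousAt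
  have hB : 0 ≤ B := (abs_nonneg _).trans (hgB 0 le_rfl hT.le)
  have hC : 0 ≤ C := by
    have := (norm_nonneg _).trans (hnC 0 0)
    simpa using this
  have hcont : ∀ u : ℝ → ℝ, Continuous u → Continuous (fun z : ℝ × ℝ × ℝ =>
      ∫ w in (0:ℝ)..z.1, (u (z.2.1 + (z.1 - w)) : ℂ) *
        Complex.exp (κ z.2.2 * ((z.1 - w : ℝ) : ℂ)) * n w z.2.2) := by
    intro u hu
    refine intervalIntegral.continuous_parametric_intervalIntegral_of_continuous
      (f := fun (z : ℝ × ℝ × ℝ) w => (u (z.2.1 + (z.1 - w)) : ℂ) *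
        Complex.exp (κ z.2.2 * ((z.1 - w : ℝ) : ℂ)) * n w z.2.2) ?_ continuous_fst
    have h1 : Continuous (fun z : (ℝ × ℝ × ℝ) × ℝ => n z.2 z.1.2.2) :=
      hn.comp (by fun_prop : Continuous (fun z : (ℝ × ℝ × ℝ) × ℝ => (z.2, z.1.2.2)))
    simp only [Function.uncurry_def]
    fun_prop
  have hexp : ∀ ω z, 0 ≤ z → ‖Complex.exp (κ ω * (z : ℝ))‖ ≤ Real.exp (- c ω * z) := by
    intro ω z hz
    rw [Complex.norm_exp]
    apply Real.exp_le_exp.2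
    simp only [Complex.re_mul_ofReal]
    exact mul_le_mul_of_nonneg_right (hκc ω) hz
  have hbound : ∀ u : ℝ → ℝ, (∀ x, 0 ≤ x → x ≤ T → |u x| ≤ B) → ∀ τ y ω, 0 ≤ τ → 0 ≤ y → τ + y ≤ T →
      ‖∫ w in (0:ℝ)..τ, (u (y + (τ - w)) : ℂ) *
        Complex.exp (κ ω * ((τ - w : ℝ) : ℂ)) * n w ω‖ ≤ (B * C * T) * Real.exp (- c ω * τ) := by
    intro u hu τ y ω h1 h2 h3
    have : ∀ w ∈ Set.uIoc 0 τ, ‖(u (y + (τ - w)) : ℂ) *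
        Complex.exp (κ ω * ((τ - w : ℝ) : ℂ)) * n w ω‖ ≤ B * C * Real.exp (- c ω * τ) := by
      intro w hw
      rw [Set.uIoc_of_le h1] at hw
      obtain ⟨w1, w2⟩ := hw
      rw [norm_mul, norm_mul, Complex.norm_real, Real.norm_eq_abs]
      have e : Real.exp (- c ω * τ) = Real.exp (- c ω * (τ - w)) * Real.exp (- c ω * w) := by
        rw [← Real.exp_add]; ring_nf
      rw [e]
      calc _ ≤ B * Real.exp (- c ω * (τ - w)) * (C * Real.exp (- c ω * w)) := by
            gcongr
            · exact hu _ (by linarith) (by linarith)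
            · exact hexp ω _ (by linarith)
            · exact hnC w ω
        _ = _ := by ring
    refine (intervalIntegral.norm_integral_le_of_norm_le_const this).trans ?_
    rw [sub_zero, abs_of_nonneg h1]
    have : (B * C * Real.exp (- c ω * τ)) * τ ≤ (B * C * Real.exp (- c ω * τ)) * T :=
      mul_le_mul_of_nonneg_left (by linarith) (by positivity)
    linarith
  refine ⟨fun τ y ω => ((1 - G (τ + y) : ℝ) : ℂ) * Complex.exp (κ ω * τ) +
      ∫ w in (0:ℝ)..τ, (g (y + (τ - w)) : ℂ) * Complex.exp (κ ω * ((τ - w : ℝ) : ℂ)) * n w ω,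
    fun τ y ω => ((- g (τ + y) : ℝ) : ℂ) * Complex.exp (κ ω * τ) +
      ∫ w in (0:ℝ)..τ, (g' (y + (τ - w)) : ℂ) * Complex.exp (κ ω * ((τ - w : ℝ) : ℂ)) * n w ω,
    ?_, ?_, ?_, ?_, ?_, ?_, ?_, ?_⟩
  · exact Continuous.add (by fun_prop) (hcont g hgc)
  · exact Continuous.add (by fun_prop) (hcont g' hg')
  · intro τ y ω
    refine HasDerivAt.fun_add ?_ ?_
    · refine HasDerivAt.mul_const ?_ _
      refine HasDerivAt.ofReal_comp ?_
      exact ((hG (τ + y)).comp_const_add τ y).const_sub 1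
    · have hnw : Continuous (fun z : ℝ × ℝ => n z.2 ω) := hn.comp (by fun_prop : Continuous fun z : ℝ × ℝ => (z.2, ω))
      refine aux_param (fun y w => (g (y + (τ - w)) : ℂ) * Complex.exp (κ ω * ((τ - w : ℝ) : ℂ)) * n w ω)
        (fun y w => (g' (y + (τ - w)) : ℂ) * Complex.exp (κ ω * ((τ - w : ℝ) : ℂ)) * n w ω) ?_ ?_ ?_ 0 τ y
      · intro y w
        exact (((hg _).comp_add_const y (τ - w)).ofReal_comp.mul_const _).mul_const _
      · simp only [Function.uncurry_def]; fun_prop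
      · simp only [Function.uncurry_def]; fun_prop
  · intro τ y ω
    have hnw : Continuous (fun z : ℝ => n z ω) := hn.comp (by fun_prop : Continuous fun z : ℝ => (z, ω))
    have hE : ∀ z : ℝ, HasDerivAt (fun z : ℝ => Complex.exp (κ ω * (z : ℂ)))
        (Complex.exp (κ ω * (z : ℂ)) * κ ω) z := by
      intro z
      have := ((hasDerivAt_id' (z : ℂ)).const_mul (κ ω)).cexp.comp_ofReal
      simpa using this
    have h1 : HasDerivAt (fun τ : ℝ => ((1 - G (τ + y) : ℝ) : ℂ) * Complex.exp (κ ω * τ))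
        (((- g (τ + y) : ℝ) : ℂ) * Complex.exp (κ ω * τ) +
          ((1 - G (τ + y) : ℝ) : ℂ) * (Complex.exp (κ ω * τ) * κ ω)) τ := by
      refine HasDerivAt.fun_mul ?_ (hE τ)
      refine HasDerivAt.ofReal_comp ?_
      exact ((hG (τ + y)).comp_add_const τ y).const_sub 1
    have h2 := aux_leibniz (fun z => (g (y + z) : ℂ) * Complex.exp (κ ω * (z : ℂ)))
      (fun z => (g' (y + z) : ℂ) * Complex.exp (κ ω * (z : ℂ)) +
        (g (y + z) : ℂ) * (Complex.exp (κ ω * (z : ℂ)) * κ ω)) (fun w => n w ω)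
      (fun z => HasDerivAt.fun_mul (((hg (y + z)).comp_const_add y z).ofReal_comp) (hE z))
      (by fun_prop) hnw τ
    refine (HasDerivAt.fun_add h1 h2).congr_deriv ?_
    have e : ∫ w in (0:ℝ)..τ, ((g' (y + (τ - w)) : ℂ) * Complex.exp (κ ω * ((τ - w : ℝ) : ℂ)) +
        (g (y + (τ - w)) : ℂ) * (Complex.exp (κ ω * ((τ - w : ℝ) : ℂ)) * κ ω)) * n w ω
        = (∫ w in (0:ℝ)..τ, (g' (y + (τ - w)) : ℂ) * Complex.exp (κ ω * ((τ - w : ℝ) : ℂ)) * n w ω)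
        + κ ω * ∫ w in (0:ℝ)..τ, (g (y + (τ - w)) : ℂ) * Complex.exp (κ ω * ((τ - w : ℝ) : ℂ)) * n w ω := by
      rw [← intervalIntegral.integral_const_mul, ← intervalIntegral.integral_add]
      · congr 1
        funext w
        ring
      · exact Continuous.intervalIntegrable (by fun_prop) _ _
      · exact Continuous.intervalIntegrable (by fun_prop) _ _
    rw [e]
    simp only [add_zero, Complex.ofReal_zero, mul_zero, Complex.exp_zero, mul_one]
    ring
  · intro y ω
    simp
  · intro τ ω
    simp
  · refine ⟨B + B * C * T, fun τ y ω h1 h2 h3 => ?_⟩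
    refine (norm_add_le _ _).trans ?_
    rw [add_mul]
    refine add_le_add ?_ (hbound g hgB τ y ω h1 h2 h3)
    rw [norm_mul, Complex.norm_real, Real.norm_eq_abs]
    exact mul_le_mul (hGB _ (by linarith) h3) (hexp ω τ h1) (norm_nonneg _) hB
  · refine ⟨B + B * C * T, fun τ y ω h1 h2 h3 => ?_⟩
    refine (norm_add_le _ _).trans ?_
    rw [add_mul]
    refine add_le_add ?_ (hbound g' hg'B τ y ω h1 h2 h3)
    rw [norm_mul, Complex.norm_real, Real.norm_eq_abs, abs_neg]
    exact mul_le_mul (hgB _ (by linarith) h3) (hexp ω τ h1) (norm_nonneg _) hB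

/-- The critical exponent `1/2 + iω`. -/
noncomputable def auxLam (ω : ℝ) : ℂ := 1 / 2 + ω * Complex.I

/-- Symbols with Gaussian decay in the frequency. -/
def AuxSym (m T : ℝ) (b : ℝ → ℝ → ℝ → ℂ) : Prop :=
  ContinuousOn (fun z : ℝ × ℝ × ℝ => b z.1 z.2.1 z.2.2) {z | 0 ≤ z.2.1} ∧
  ∃ C : ℝ, ∀ τ y ω, 0 ≤ τ → 0 ≤ y → τ + y ≤ T → ‖b τ y ω‖ ≤ C * Real.exp (- (m * (1 / 4 + ω^2)) * τ)

/-- Mellin synthesis. -/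
noncomputable def auxJ (T : ℝ) (n : ℕ) (b : ℝ → ℝ → ℝ → ℂ) (t s y : ℝ) : ℂ :=
  ∫ ω : ℝ, (s : ℂ) ^ (auxLam ω - n) * b (T - t) y ω

lemma auxLam_cont : Continuous auxLam := by unfold auxLam; fun_prop

lemma auxLam_re (ω : ℝ) : (auxLam ω).re = 1 / 2 := by
  simp [auxLam]

lemma auxLam_im (ω : ℝ) : (auxLam ω).im = ω := by
  simp [auxLam]

lemma aux_norm_pow (s : ℝ) (hs : 0 < s) (n : ℕ) (ω : ℝ) :
    ‖(s : ℂ) ^ (auxLam ω - n)‖ = s ^ ((1 / 2 : ℝ) - n) := by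
  rw [Complex.norm_cpow_eq_rpow_re_of_pos hs]
  simp [auxLam_re]

lemma aux_meas_pow (s : ℝ) (n : ℕ) : Measurable fun ω : ℝ => (s : ℂ) ^ (auxLam ω - n) := by
  have := auxLam_cont.measurable
  fun_prop

lemma aux_sym_slice {m T : ℝ} {b : ℝ → ℝ → ℝ → ℂ} (hb : AuxSym m T b) (τ y : ℝ) (hy : 0 ≤ y) :
    Continuous (fun ω => b τ y ω) := by
  rw [← continuousOn_univ]
  exact hb.1.comp (by fun_prop : ContinuousOn (fun ω : ℝ => (τ, y, ω)) Set.univ) (fun ω _ => hy)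

lemma aux_meas {m T : ℝ} {b : ℝ → ℝ → ℝ → ℂ} (hb : AuxSym m T b) (n : ℕ) (τ s y : ℝ) (hy : 0 ≤ y) :
    AEStronglyMeasurable (fun ω => (s : ℂ) ^ (auxLam ω - n) * b τ y ω) volume :=
  ((aux_meas_pow s n).aestronglyMeasurable).mul (aux_sym_slice hb τ y hy).aestronglyMeasurable

lemma aux_gauss_int (m C τ : ℝ) (hm : 0 < m) (hτ : 0 < τ) :
    Integrable (fun ω : ℝ => C * Real.exp (- (m * (1 / 4 + ω^2)) * τ)) := by
  have h := (integrable_exp_neg_mul_sq (mul_pos hm hτ)).const_mul (C * Real.exp (- (m / 4 * τ)))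
  refine h.congr (Filter.Eventually.of_forall fun ω => ?_)
  simp only
  rw [mul_assoc, ← Real.exp_add]
  congr 2
  ring

/-- Local domination for the synthesis integrals. -/
lemma aux_dom {m T : ℝ} (hm : 0 < m) {b : ℝ → ℝ → ℝ → ℂ} (hb : AuxSym m T b) (n : ℕ)
    (q0 : ℝ × ℝ × ℝ) (hq0 : q0 ∈ domD T) :
    ∃ bd : ℝ → ℝ, Integrable bd ∧ ∀ᶠ q in nhds q0, q ∈ domD T ∧
      ∀ ω, ‖(q.2.1 : ℂ) ^ (auxLam ω - n) * b (T - q.1) q.2.2 ω‖ ≤ bd ω := by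
  obtain ⟨C, hC⟩ := hb.2
  obtain ⟨a1, a2, a3, a4, a5⟩ := id hq0
  have hcont : ContinuousAt (fun q : ℝ × ℝ × ℝ => q.2.1 ^ ((1 / 2 : ℝ) - n)) q0 := by
    refine ContinuousAt.rpow_const (by fun_prop) (Or.inl a3.ne')
  have e1 : ∀ᶠ q : ℝ × ℝ × ℝ in nhds q0, q.2.1 ^ ((1 / 2 : ℝ) - n) < q0.2.1 ^ ((1 / 2 : ℝ) - n) + 1 :=
    hcont.eventually (gt_mem_nhds (by linarith))
  have e2 : ∀ᶠ q : ℝ × ℝ × ℝ in nhds q0, (T - q0.1) / 2 < T - q.1 :=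
    (by fun_prop : ContinuousAt (fun q : ℝ × ℝ × ℝ => T - q.1) q0).eventually
      (lt_mem_nhds (by linarith))
  refine ⟨fun ω => ((q0.2.1 ^ ((1 / 2 : ℝ) - n) + 1) * |C|) *
    Real.exp (- (m * (1 / 4 + ω^2)) * ((T - q0.1) / 2)),
    aux_gauss_int m _ _ hm (by linarith), ?_⟩
  filter_upwards [e1, e2, (aux_open T).mem_nhds hq0] with q h1 h2 hq
  refine ⟨hq, fun ω => ?_⟩
  obtain ⟨b1, b2, b3, b4, b5⟩ := id hq
  rw [norm_mul, aux_norm_pow _ b3]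
  have h3 := hC (T - q.1) q.2.2 ω (by linarith) b4.le (by linarith)
  have h4 : Real.exp (- (m * (1 / 4 + ω^2)) * (T - q.1)) ≤
      Real.exp (- (m * (1 / 4 + ω^2)) * ((T - q0.1) / 2)) := by
    apply Real.exp_le_exp.2
    have : 0 < m * (1 / 4 + ω^2) := by positivity
    nlinarith
  have h5 : 0 < q.2.1 ^ ((1 / 2 : ℝ) - n) := Real.rpow_pos_of_pos b3 _
  calc _ ≤ (q0.2.1 ^ ((1 / 2 : ℝ) - n) + 1) * (|C| *
        Real.exp (- (m * (1 / 4 + ω^2)) * ((T - q0.1) / 2))) := by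
        refine mul_le_mul h1.le (h3.trans ?_) (norm_nonneg _) (by linarith)
        exact mul_le_mul (le_abs_self C) h4 (Real.exp_nonneg _) (abs_nonneg _)
    _ = _ := by ring

lemma aux_J_int {m T : ℝ} (hm : 0 < m) {b : ℝ → ℝ → ℝ → ℂ} (hb : AuxSym m T b) (n : ℕ)
    (t s y : ℝ) (hq : (t, s, y) ∈ domD T) :
    Integrable (fun ω : ℝ => (s : ℂ) ^ (auxLam ω - n) * b (T - t) y ω) := by
  obtain ⟨bd, h1, h2⟩ := aux_dom hm hb n (t, s, y) hq
  exact h1.mono' (aux_meas hb n _ _ _ hq.2.2.2.1.le)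
    (Filter.Eventually.of_forall fun ω => h2.self_of_nhds.2 ω)

lemma aux_J_cont {m T : ℝ} (hm : 0 < m) {b : ℝ → ℝ → ℝ → ℂ} (hb : AuxSym m T b) (n : ℕ) :
    ContinuousOn (fun q : ℝ × ℝ × ℝ => auxJ T n b q.1 q.2.1 q.2.2) (domD T) := by
  intro q0 hq0
  obtain ⟨bd, h1, h2⟩ := aux_dom hm hb n q0 hq0
  have h2' := h2.filter_mono (nhdsWithin_le_nhds (s := domD T))
  unfold auxJ
  refine continuousWithinAt_of_dominated (bound := bd) ?_ ?_ h1 ?_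
  · filter_upwards [h2'] with q hq
    exact aux_meas hb n _ _ _ hq.1.2.2.2.1.le
  · filter_upwards [h2'] with q hq
    exact Filter.Eventually.of_forall hq.2
  · refine Filter.Eventually.of_forall fun ω => ?_
    refine ContinuousWithinAt.mul ?_ ?_
    · refine ContinuousAt.continuousWithinAt ?_
      have : ContinuousAt (fun s : ℝ => (s : ℂ) ^ (auxLam ω - n)) q0.2.1 :=
        Complex.continuousAt_ofReal_cpow_const _ _ (Or.inr hq0.2.2.1.ne')
      exact this.comp (f := fun q : ℝ × ℝ × ℝ => q.2.1) (by fun_prop)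
    · have := (hb.1 (T - q0.1, q0.2.2, ω) hq0.2.2.2.1.le)
      exact this.comp (f := fun q : ℝ × ℝ × ℝ => (T - q.1, q.2.2, ω))
        (by fun_prop) (fun q hq => hq.2.2.2.1.le)

lemma aux_J_s {m T : ℝ} (hm : 0 < m) {b : ℝ → ℝ → ℝ → ℂ} (hb : AuxSym m T b) (n : ℕ)
    (hb' : AuxSym m T (fun τ y ω => (auxLam ω - n) * b τ y ω))
    (t s y : ℝ) (hq : (t, s, y) ∈ domD T) :
    HasDerivAt (fun s => auxJ T n b t s y)
      (auxJ T (n + 1) (fun τ y ω => (auxLam ω - n) * b τ y ω) t s y) s := by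
  obtain ⟨bd, h1, h2⟩ := aux_dom hm hb' (n + 1) (t, s, y) hq
  have h3 := (by fun_prop : ContinuousAt (fun s : ℝ => (t, s, y)) s).eventually h2
  obtain ⟨U, hU, h4⟩ := h3.exists_mem
  unfold auxJ
  refine (hasDerivAt_integral_of_dominated_loc_of_deriv_le (bound := bd)
    (F := fun (s : ℝ) (ω : ℝ) => (s : ℂ) ^ (auxLam ω - n) * b (T - t) y ω)
    (F' := fun (s : ℝ) (ω : ℝ) => (s : ℂ) ^ (auxLam ω - ((n + 1 : ℕ) : ℂ)) * ((auxLam ω - n) * b (T - t) y ω))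
    hU ?_ ?_ ?_ ?_ h1 ?_).2
  · exact Filter.Eventually.of_forall fun z => aux_meas hb n _ _ _ hq.2.2.2.1.le
  · exact aux_J_int hm hb n t s y hq
  · exact aux_meas hb' (n + 1) _ _ _ hq.2.2.2.1.le
  · exact Filter.Eventually.of_forall fun ω z hz => (h4 z hz).2 ω
  · refine Filter.Eventually.of_forall fun ω z hz => ?_
    have hz0 : z ≠ 0 := (h4 z hz).1.2.2.1.ne'
    have hne : auxLam ω - n ≠ 0 := by
      intro h0
      have := congrArg Complex.re h0
      simp only [Complex.sub_re, auxLam_re, Complex.natCast_re, Complex.zero_re] at this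
      have h7 : (2 * n : ℝ) = 1 := by linarith
      have h8 : 2 * n = 1 := by exact_mod_cast h7
      omega
    refine ((hasDerivAt_ofReal_cpow_const hz0 hne).mul_const _).congr_deriv ?_
    push_cast
    rw [sub_sub]
    ring

lemma aux_J_y {m T : ℝ} (hm : 0 < m) {b b' : ℝ → ℝ → ℝ → ℂ} (hb : AuxSym m T b) (n : ℕ)
    (hb' : AuxSym m T b')
    (hd : ∀ τ y ω, 0 < y → HasDerivAt (fun y => b τ y ω) (b' τ y ω) y)
    (t s y : ℝ) (hq : (t, s, y) ∈ domD T) :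
    HasDerivAt (fun y => auxJ T n b t s y) (auxJ T n b' t s y) y := by
  obtain ⟨bd, h1, h2⟩ := aux_dom hm hb' n (t, s, y) hq
  have h3 := (by fun_prop : ContinuousAt (fun y : ℝ => (t, s, y)) y).eventually h2
  unfold auxJ
  refine (hasDerivAt_integral_of_dominated_loc_of_deriv_le (bound := bd)
    (F := fun y ω => (s : ℂ) ^ (auxLam ω - n) * b (T - t) y ω)
    (F' := fun y ω => (s : ℂ) ^ (auxLam ω - n) * b' (T - t) y ω)
    h3 ?_ ?_ ?_ ?_ h1 ?_).2
  · exact h3.mono fun z hz => aux_meas hb n _ _ _ hz.1.2.2.2.1.le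
  · exact aux_J_int hm hb n t s y hq
  · exact aux_meas hb' n _ _ _ hq.2.2.2.1.le
  · exact Filter.Eventually.of_forall fun ω z hz => hz.2 ω
  · exact Filter.Eventually.of_forall fun ω z hz => (hd _ _ _ hz.1.2.2.2.1).const_mul _

lemma aux_J_t {m T : ℝ} (hm : 0 < m) {b b' : ℝ → ℝ → ℝ → ℂ} (hb : AuxSym m T b) (n : ℕ)
    (hb' : AuxSym m T b')
    (hd : ∀ τ y ω, 0 < y → HasDerivAt (fun τ => b τ y ω) (b' τ y ω) τ)
    (t s y : ℝ) (hq : (t, s, y) ∈ domD T) :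
    HasDerivAt (fun t => auxJ T n b t s y) (- auxJ T n b' t s y) t := by
  obtain ⟨bd, h1, h2⟩ := aux_dom hm hb' n (t, s, y) hq
  have h3 := (by fun_prop : ContinuousAt (fun t : ℝ => (t, s, y)) t).eventually h2
  have := (hasDerivAt_integral_of_dominated_loc_of_deriv_le (bound := bd) (x₀ := t) (μ := volume)
    (F := fun t ω => (s : ℂ) ^ (auxLam ω - n) * b (T - t) y ω)
    (F' := fun t ω => (s : ℂ) ^ (auxLam ω - n) * (- b' (T - t) y ω))
    h3 ?_ ?_ ?_ ?_ h1 ?_).2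
  · unfold auxJ
    refine this.congr_deriv ?_
    simp only [mul_neg, integral_neg]
  · exact h3.mono fun z hz => aux_meas hb n _ _ _ hz.1.2.2.2.1.le
  · exact aux_J_int hm hb n t s y hq
  · simp only [mul_neg]
    exact (aux_meas hb' n _ _ _ hq.2.2.2.1.le).neg
  · refine Filter.Eventually.of_forall fun ω z hz => ?_
    simp only [mul_neg, norm_neg]
    exact hz.2 ω
  · refine Filter.Eventually.of_forall fun ω z hz => HasDerivAt.const_mul _ ?_
    exact (hd _ _ ω hz.1.2.2.2.1).comp_const_sub T z

/-- The Lorentzian weight. -/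
noncomputable def auxQ (ω : ℝ) : ℝ := 1 / (2 * π * (1 / 4 + ω^2))

lemma auxQ_pos (ω : ℝ) : 0 < auxQ ω := by
  unfold auxQ
  positivity

lemma auxQ_int : Integrable auxQ := aux_lor_int

lemma auxQ_cont : Continuous auxQ := by
  unfold auxQ
  refine Continuous.div (by fun_prop) (by fun_prop) fun ω => ?_
  positivity

lemma auxQ_mul (ω : ℝ) : auxQ ω * (1 / 4 + ω^2) ≤ 1 := by
  unfold auxQ
  have h1 : 0 < 1 / 4 + ω^2 := by positivity
  have h2 : 1 / (2 * π * (1 / 4 + ω^2)) * (1 / 4 + ω^2) = 1 / (2 * π) := by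
    field_simp
  rw [h2, div_le_one (by positivity)]
  linarith [Real.pi_gt_three]

lemma auxQ_le (ω : ℝ) : auxQ ω ≤ 4 := by
  have h1 := auxQ_mul ω
  have h2 := auxQ_pos ω
  nlinarith [mul_nonneg h2.le (sq_nonneg ω)]

/-- The Mellin weight of the payoff. -/
noncomputable def auxW (K : ℝ) (ω : ℝ) : ℂ := (K : ℂ) ^ (1 - auxLam ω) * (auxQ ω : ℂ)

lemma auxW_cont (K : ℝ) (hK : 0 < K) : Continuous (auxW K) := by
  unfold auxW
  refine Continuous.mul ?_ (by have := auxQ_cont; fun_prop)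
  refine Continuous.const_cpow (by have := auxLam_cont; fun_prop) (Or.inl ?_)
  exact_mod_cast hK.ne'

lemma auxW_norm (K : ℝ) (hK : 0 < K) (ω : ℝ) : ‖auxW K ω‖ = √K * auxQ ω := by
  unfold auxW
  rw [norm_mul, Complex.norm_cpow_eq_rpow_re_of_pos hK, Complex.norm_real, Real.norm_eq_abs,
    abs_of_pos (auxQ_pos ω), Real.sqrt_eq_rpow]
  congr 2
  simp [auxLam_re]
  norm_num

lemma aux_terminal (K s : ℝ) (hK : 0 < K) (hs : 0 < s) :
    ∫ ω : ℝ, (s : ℂ) ^ (auxLam ω - ((0 : ℕ) : ℂ)) * auxW K ω = ((min s K : ℝ) : ℂ) := by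
  have e : ∀ ω : ℝ, (s : ℂ) ^ (auxLam ω - ((0 : ℕ) : ℂ)) * auxW K ω =
      ((Real.exp ((Real.log s + Real.log K) / 2) : ℝ) : ℂ) *
      (Complex.exp (ω * ((Real.log s - Real.log K : ℝ) : ℂ) * Complex.I) *
        ((1 / (2 * π * (1/4 + ω^2)) : ℝ) : ℂ)) := by
    intro ω
    unfold auxW auxQ
    rw [Complex.cpow_def_of_ne_zero (by exact_mod_cast hs.ne'),
      Complex.cpow_def_of_ne_zero (by exact_mod_cast hK.ne'), ← Complex.ofReal_log hs.le,
      ← Complex.ofReal_log hK.le, ← mul_assoc, ← mul_assoc, Complex.ofReal_exp, ← Complex.exp_add,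
      ← Complex.exp_add]
    congr 2
    unfold auxLam
    push_cast
    ring
  simp_rw [e]
  rw [integral_const_mul, aux_fourier, ← Complex.ofReal_mul, ← Real.exp_add]
  congr 1
  rcases le_total s K with h | h
  · have h1 := Real.log_le_log hs h
    rw [min_eq_left h, abs_of_nonpos (by linarith)]
    rw [show (Real.log s + Real.log K) / 2 + -(-(Real.log s - Real.log K)) / 2 = Real.log s by ring,
      Real.exp_log hs]
  · have h1 := Real.log_le_log hK h
    rw [min_eq_right h, abs_of_nonneg (by linarith)]
    rw [show (Real.log s + Real.log K) / 2 + -(Real.log s - Real.log K) / 2 = Real.log K by ring,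
      Real.exp_log hK]

lemma aux_pow_le (s : ℝ) (hs : 0 ≤ s) (ω : ℝ) :
    ‖(s : ℂ) ^ (auxLam ω - ((0 : ℕ) : ℂ))‖ ≤ √s := by
  rcases hs.lt_or_eq with h | h
  · rw [aux_norm_pow s h, Real.sqrt_eq_rpow]
    simp
  · rw [← h]
    have : auxLam ω - ((0 : ℕ) : ℂ) ≠ 0 := by
      intro h0
      have := congrArg Complex.re h0
      simp [auxLam_re] at this
    rw [Complex.ofReal_zero, Complex.zero_cpow this]
    simp

lemma aux_J_zero (T : ℝ) (b : ℝ → ℝ → ℝ → ℂ) (t y : ℝ) : auxJ T 0 b t 0 y = 0 := by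
  unfold auxJ
  have : ∀ ω : ℝ, ((0 : ℝ) : ℂ) ^ (auxLam ω - ((0 : ℕ) : ℂ)) = 0 := by
    intro ω
    have := aux_pow_le 0 le_rfl ω
    simpa using this
  simp only [this, zero_mul, integral_zero]

lemma aux_J_bound {m T : ℝ} {b : ℝ → ℝ → ℝ → ℂ} (hb : AuxSym m T b) (C : ℝ) (hC0 : 0 ≤ C)
    (hC : ∀ τ y ω, 0 ≤ τ → 0 ≤ y → τ + y ≤ T → ‖b τ y ω‖ ≤ C * auxQ ω)
    (t s y : ℝ) (hq : (t, s, y) ∈ domDbar T) :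
    ‖auxJ T 0 b t s y‖ ≤ √s * (C * ∫ ω, auxQ ω) := by
  obtain ⟨a1, a2, a3, a4, a5⟩ := hq
  simp only at a1 a2 a3 a4 a5
  unfold auxJ
  rw [← integral_const_mul, ← integral_const_mul]
  refine norm_integral_le_of_norm_le ((auxQ_int.const_mul C).const_mul (√s))
    (Filter.Eventually.of_forall fun ω => ?_)
  rw [norm_mul]
  exact mul_le_mul (aux_pow_le s a3 ω) (hC _ _ _ (by linarith) a4 (by linarith)) (norm_nonneg _)
    (Real.sqrt_nonneg _)

lemma aux_J_closure {m T : ℝ} {b : ℝ → ℝ → ℝ → ℂ} (hb : AuxSym m T b) (C : ℝ) (hC0 : 0 ≤ C)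
    (hC : ∀ τ y ω, 0 ≤ τ → 0 ≤ y → τ + y ≤ T → ‖b τ y ω‖ ≤ C * auxQ ω) :
    ContinuousOn (fun q : ℝ × ℝ × ℝ => auxJ T 0 b q.1 q.2.1 q.2.2) (domDbar T) := by
  intro q0 hq0
  have e2 : ∀ᶠ q : ℝ × ℝ × ℝ in nhds q0, q.2.1 < q0.2.1 + 1 :=
    (by fun_prop : ContinuousAt (fun q : ℝ × ℝ × ℝ => q.2.1) q0).eventually
      (gt_mem_nhds (by linarith))
  have e3 := e2.filter_mono (nhdsWithin_le_nhds (s := domDbar T))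
  unfold auxJ
  refine continuousWithinAt_of_dominated (bound := fun ω => √(q0.2.1 + 1) * (C * auxQ ω)) ?_ ?_
    ((auxQ_int.const_mul C).const_mul _) ?_
  · filter_upwards [self_mem_nhdsWithin] with q hq
    exact aux_meas hb 0 _ _ _ hq.2.2.2.1
  · filter_upwards [self_mem_nhdsWithin, e3] with q hq h3
    obtain ⟨a1, a2, a3, a4, a5⟩ := hq
    refine Filter.Eventually.of_forall fun ω => ?_
    rw [norm_mul]
    exact mul_le_mul ((aux_pow_le _ a3 ω).trans (Real.sqrt_le_sqrt h3.le))
      (hC _ _ _ (by linarith) a4 (by linarith)) (norm_nonneg _) (Real.sqrt_nonneg _)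
  · refine Filter.Eventually.of_forall fun ω => ?_
    refine ContinuousWithinAt.mul ?_ ?_
    · refine ContinuousAt.continuousWithinAt ?_
      have : Continuous (fun s : ℝ => (s : ℂ) ^ (auxLam ω - ((0 : ℕ) : ℂ))) :=
        Complex.continuous_ofReal_cpow_const (by simp [auxLam_re])
      exact this.continuousAt.comp (f := fun q : ℝ × ℝ × ℝ => q.2.1) (by fun_prop)
    · have := (hb.1 (T - q0.1, q0.2.2, ω) hq0.2.2.2.1)
      exact this.comp (f := fun q : ℝ × ℝ × ℝ => (T - q.1, q.2.2, ω))
        (by fun_prop) (fun q hq => hq.2.2.2.1)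

lemma aux_sym_zero {m T : ℝ} {b : ℝ → ℝ → ℝ → ℂ} (hb : AuxSym m T b) :
    AuxSym m T (fun τ _ ω => b τ 0 ω) := by
  obtain ⟨h1, C, hC⟩ := hb
  refine ⟨?_, C, fun τ y ω a1 a2 a3 => hC τ 0 ω a1 le_rfl (by linarith)⟩
  exact h1.comp (by fun_prop : ContinuousOn (fun z : ℝ × ℝ × ℝ => (z.1, (0:ℝ), z.2.2)) {z | 0 ≤ z.2.1})
    (fun z _ => le_refl (0:ℝ))

lemma aux_J_pde {k : ℕ} {m T : ℝ} (hm : 0 < m) (R V h : ℝ) (pv : Fin k → ℝ)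
    (b b' bt : ℝ → ℝ → ℝ → ℂ) (bj : Fin k → ℝ → ℝ → ℝ → ℂ)
    (hb : AuxSym m T b) (hb' : AuxSym m T b') (hbj : ∀ j, AuxSym m T (bj j))
    (hb1 : AuxSym m T (fun τ y ω => (auxLam ω - (0 : ℕ)) * b τ y ω))
    (hb2 : AuxSym m T (fun τ y ω => (auxLam ω - (1 : ℕ)) * ((auxLam ω - (0 : ℕ)) * b τ y ω)))
    (t s y : ℝ) (hq : (t, s, y) ∈ domD T)
    (hrel : ∀ ω, bt (T - t) y ω = (R * (auxLam ω - 1) + V * (auxLam ω * (auxLam ω - 1))) * b (T - t) y ω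
      + b' (T - t) y ω + h * (∑ j, (pv j : ℂ) * bj j (T - t) 0 ω - b (T - t) y ω)) :
    auxJ T 0 bt t s y = ((R * s : ℝ) : ℂ) * auxJ T 1 (fun τ y ω => (auxLam ω - (0 : ℕ)) * b τ y ω) t s y
      + ((V * s^2 : ℝ) : ℂ) * auxJ T 2 (fun τ y ω => (auxLam ω - (1 : ℕ)) * ((auxLam ω - (0 : ℕ)) * b τ y ω)) t s y
      + auxJ T 0 b' t s y + (h : ℂ) * (∑ j, (pv j : ℂ) * auxJ T 0 (bj j) t s 0)
      + ((-(R + h) : ℝ) : ℂ) * auxJ T 0 b t s y := by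
  have i0 := aux_J_int hm hb 0 t s y hq
  have i1 := aux_J_int hm hb1 1 t s y hq
  have i2 := aux_J_int hm hb2 2 t s y hq
  have i3 := aux_J_int hm hb' 0 t s y hq
  have i4 := fun j => aux_J_int hm (aux_sym_zero (hbj j)) 0 t s y hq
  have hs : (s : ℂ) ≠ 0 := by exact_mod_cast hq.2.2.1.ne'
  have p1 : ∀ ω, (s : ℂ) ^ (auxLam ω - (0 : ℕ)) = s * (s : ℂ) ^ (auxLam ω - (1 : ℕ)) := by
    intro ω
    rw [show auxLam ω - (0 : ℕ) = (auxLam ω - (1 : ℕ)) + 1 by push_cast; ring,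
      Complex.cpow_add _ _ hs, Complex.cpow_one]
    ring
  have p2 : ∀ ω, (s : ℂ) ^ (auxLam ω - (0 : ℕ)) = s^2 * (s : ℂ) ^ (auxLam ω - (2 : ℕ)) := by
    intro ω
    rw [p1 ω, show auxLam ω - (1 : ℕ) = (auxLam ω - (2 : ℕ)) + 1 by push_cast; ring,
      Complex.cpow_add _ _ hs, Complex.cpow_one]
    ring
  unfold auxJ
  have hsum : (h : ℂ) * (∑ j, (pv j : ℂ) * ∫ ω : ℝ, (s : ℂ) ^ (auxLam ω - (0 : ℕ)) * bj j (T - t) 0 ω)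
      = ∫ ω : ℝ, (h : ℂ) * ∑ j, (pv j : ℂ) * ((s : ℂ) ^ (auxLam ω - (0 : ℕ)) * bj j (T - t) 0 ω) := by
    rw [integral_const_mul, integral_finset_sum _ (fun j _ => (i4 j).const_mul _)]
    simp only [integral_const_mul]
  have i5 : Integrable (fun ω : ℝ => (h : ℂ) * ∑ j, (pv j : ℂ) *
      ((s : ℂ) ^ (auxLam ω - (0 : ℕ)) * bj j (T - t) 0 ω)) :=
    (integrable_finset_sum _ (fun j _ => (i4 j).const_mul _)).const_mul _
  have j1 := i1.const_mul ((R * s : ℝ) : ℂ)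
  have j2 := i2.const_mul ((V * s^2 : ℝ) : ℂ)
  have j0 := i0.const_mul ((-(R + h) : ℝ) : ℂ)
  have j12 := j1.fun_add j2
  have j123 := j12.fun_add i3
  have j1235 := j123.fun_add i5
  rw [hsum, ← integral_const_mul, ← integral_const_mul, ← integral_const_mul,
    ← integral_add j1 j2, ← integral_add j12 i3, ← integral_add j123 i5, ← integral_add j1235 j0]
  refine integral_congr_ae (Filter.Eventually.of_forall fun ω => ?_)
  simp only [Pi.add_apply]
  rw [hrel ω]
  have e : ∑ j, (pv j : ℂ) * ((s : ℂ) ^ (auxLam ω - (0 : ℕ)) * bj j (T - t) 0 ω)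
      = (s : ℂ) ^ (auxLam ω - (0 : ℕ)) * ∑ j, (pv j : ℂ) * bj j (T - t) 0 ω := by
    rw [Finset.mul_sum]
    exact Finset.sum_congr rfl fun j _ => by ring
  rw [e]
  have q1 := p1 ω
  have q2 := p2 ω
  set S0 := (s : ℂ) ^ (auxLam ω - (0 : ℕ))
  set S1 := (s : ℂ) ^ (auxLam ω - (1 : ℕ))
  set S2 := (s : ℂ) ^ (auxLam ω - (2 : ℕ))
  push_cast
  linear_combination (R * auxLam ω * b (T - t) y ω) * q1
    + (V * (auxLam ω * (auxLam ω - 1)) * b (T - t) y ω) * q2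

/-- Existence from a family of modes. -/
lemma aux_solution {k : ℕ} (T K m : ℝ) (hT : 0 < T) (hK : 0 < K) (hm : 0 < m)
    (r σ : Fin k → ℝ) (p : Fin k → Fin k → ℝ)
    (hp1 : ∀ i, ∑ j, p i j = 1) (hpd : ∀ i, p i i = 0) (f F : Fin k → ℝ → ℝ)
    (b b' bt : Fin k → ℝ → ℝ → ℝ → ℂ)
    (hb : ∀ i, AuxSym m T (b i)) (hb' : ∀ i, AuxSym m T (b' i)) (hbt : ∀ i, AuxSym m T (bt i))
    (hb1 : ∀ i, AuxSym m T (fun τ y ω => (auxLam ω - (0 : ℕ)) * b i τ y ω))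
    (hb2 : ∀ i, AuxSym m T (fun τ y ω => (auxLam ω - (1 : ℕ)) * ((auxLam ω - (0 : ℕ)) * b i τ y ω)))
    (C : ℝ) (hC0 : 0 ≤ C)
    (hC : ∀ i τ y ω, 0 ≤ τ → 0 ≤ y → τ + y ≤ T → ‖b i τ y ω‖ ≤ C * auxQ ω)
    (hdy : ∀ i τ y ω, 0 < y → HasDerivAt (fun y => b i τ y ω) (b' i τ y ω) y)
    (hdt : ∀ i τ y ω, 0 < y → HasDerivAt (fun τ => b i τ y ω) (bt i τ y ω) τ)
    (h0 : ∀ i y ω, 0 ≤ y → b i 0 y ω = auxW K ω)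
    (hrel : ∀ i τ y ω, 0 < y → 0 ≤ τ → τ + y ≤ T →
      bt i τ y ω = ((r i : ℂ) * (auxLam ω - 1) + ((1 / 2 * σ i ^ 2 : ℝ) : ℂ) * (auxLam ω * (auxLam ω - 1))) * b i τ y ω
      + b' i τ y ω + ((f i y / (1 - F i y) : ℝ) : ℂ) * (∑ j, (p i j : ℂ) * b j τ 0 ω - b i τ y ω)) :
    ∃ φ : ℝ → ℝ → Fin k → ℝ → ℝ, IsClassicalSol r σ p f F K T φ ∧ LinGrowth T φ := by
  refine ⟨fun t s i y => s - (auxJ T 0 (b i) t s y).re, ⟨?_, ?_, ?_, ?_⟩, ?_⟩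
  · intro i
    exact ContinuousOn.sub (by fun_prop)
      (Complex.continuous_re.comp_continuousOn (aux_J_closure (hb i) C hC0 (hC i)))
  · intro t y i _ _ _ _
    simp [aux_J_zero]
  · intro s hs y hy _ i
    have : auxJ T 0 (b i) T s y = ((min s K : ℝ) : ℂ) := by
      rw [← aux_terminal K s hK hs]
      unfold auxJ
      simp only [sub_self, h0 i y _ hy]
    simp only [this, Complex.ofReal_re]
    rcases le_total s K with h | h
    · rw [min_eq_left h, max_eq_right (by linarith), sub_self]
    · rw [min_eq_right h, max_eq_left (by linarith)]
  · refine ⟨fun t s i y => (auxJ T 0 (bt i) t s y).re,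
      fun t s i y => 1 - (auxJ T 1 (fun τ y ω => (auxLam ω - (0 : ℕ)) * b i τ y ω) t s y).re,
      fun t s i y => - (auxJ T 2 (fun τ y ω => (auxLam ω - (1 : ℕ)) *
        ((auxLam ω - (0 : ℕ)) * b i τ y ω)) t s y).re,
      fun t s i y => - (auxJ T 0 (b' i) t s y).re, ?_, ?_⟩
    · intro t s y hq i
      have hre : ∀ {u : ℝ → ℂ} {u' : ℂ} {x : ℝ}, HasDerivAt u u' x →
          HasDerivAt (fun z => (u z).re) u'.re x := by
        intro u u' x hu
        exact Complex.reCLM.hasFDerivAt.comp_hasDerivAt x hu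
      refine ⟨?_, ?_, ?_, ?_, ?_⟩
      · have := hre (aux_J_t hm (hb i) 0 (hbt i) (hdt i) t s y hq)
        refine (this.const_sub s).congr_deriv ?_
        simp
      · have := hre (aux_J_s hm (hb i) 0 (hb1 i) t s y hq)
        exact HasDerivAt.fun_sub (hasDerivAt_id' s) this
      · have := hre (aux_J_s hm (hb1 i) 1 (hb2 i) t s y hq)
        exact this.const_sub 1
      · have := hre (aux_J_y hm (hb i) 0 (hb' i) (hdy i) t s y hq)
        exact this.const_sub s
      · have key := aux_J_pde hm (r i) (1 / 2 * σ i ^ 2) (f i y / (1 - F i y)) (p i) (b i) (b' i) (bt i) b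
          (hb i) (hb' i) hb (hb1 i) (hb2 i) t s y hq
          (fun ω => hrel i (T - t) y ω hq.2.2.2.1 (by linarith [hq.2.1])
            (by have := hq.2.2.2.2; simp only at this; linarith))
        have key2 := congrArg Complex.re key
        simp only [Complex.add_re, Complex.re_ofReal_mul, Complex.re_sum] at key2
        have hs : ∑ j ∈ Finset.univ.erase i, p i j * (s - (auxJ T 0 (b j) t s 0).re -
            (s - (auxJ T 0 (b i) t s y).re))
            = (auxJ T 0 (b i) t s y).re - ∑ j, p i j * (auxJ T 0 (b j) t s 0).re := by
          have e1 := Finset.add_sum_erase Finset.univ (fun j => p i j * (s - (auxJ T 0 (b j) t s 0).re -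
            (s - (auxJ T 0 (b i) t s y).re))) (Finset.mem_univ i)
          simp only [hpd i, zero_mul, zero_add] at e1
          rw [e1]
          have e2 : (auxJ T 0 (b i) t s y).re = ∑ j, p i j * (auxJ T 0 (b i) t s y).re := by
            rw [← Finset.sum_mul, hp1, one_mul]
          conv_rhs => rw [e2]
          rw [← Finset.sum_sub_distrib]
          exact Finset.sum_congr rfl fun j _ => by ring
        simp only [hs]
        rw [key2]
        ring
    · intro i
      refine ⟨?_, ?_, ?_, ?_⟩
      · exact Complex.continuous_re.comp_continuousOn (aux_J_cont hm (hbt i) 0)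
      · exact ContinuousOn.sub (by fun_prop)
          (Complex.continuous_re.comp_continuousOn (aux_J_cont hm (hb1 i) 1))
      · exact (Complex.continuous_re.comp_continuousOn (aux_J_cont hm (hb2 i) 2)).neg
      · exact (Complex.continuous_re.comp_continuousOn (aux_J_cont hm (hb' i) 0)).neg
  · refine ⟨1 + C * ∫ ω, auxQ ω, fun t s y hq i => ?_⟩
    have hbar : (t, s, y) ∈ domDbar T :=
      ⟨hq.1.le, hq.2.1.le, hq.2.2.1.le, hq.2.2.2.1.le, hq.2.2.2.2.le⟩
    have h1 := aux_J_bound (hb i) C hC0 (hC i) t s y hbar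
    have hs : 0 < s := hq.2.2.1
    have h2 : √s ≤ 1 + s := by
      rw [Real.sqrt_le_left (by linarith)]
      nlinarith
    have h3 : 0 ≤ C * ∫ ω, auxQ ω := mul_nonneg hC0 (integral_nonneg fun ω => (auxQ_pos ω).le)
    have h4 := mul_le_mul_of_nonneg_right h2 h3
    have h5 := (Complex.abs_re_le_norm (auxJ T 0 (b i) t s y)).trans h1
    have h6 := abs_sub s (auxJ T 0 (b i) t s y).re
    rw [abs_of_pos hs] at h6
    nlinarith

lemma aux_sym_add {m T : ℝ} {a b : ℝ → ℝ → ℝ → ℂ} (ha : AuxSym m T a) (hb : AuxSym m T b) :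
    AuxSym m T (fun τ y ω => a τ y ω + b τ y ω) := by
  obtain ⟨h1, C1, hC1⟩ := ha
  obtain ⟨h2, C2, hC2⟩ := hb
  refine ⟨h1.add h2, C1 + C2, fun τ y ω e1 e2 e3 => ?_⟩
  rw [add_mul]
  exact (norm_add_le _ _).trans (add_le_add (hC1 τ y ω e1 e2 e3) (hC2 τ y ω e1 e2 e3))

lemma aux_sym_y {m T : ℝ} {b : ℝ → ℝ → ℝ → ℂ} (hb : AuxSym m T b) (u : ℝ → ℂ)
    (hu : ContinuousOn u (Set.Ici 0)) : AuxSym m T (fun τ y ω => u y * b τ y ω) := by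
  obtain ⟨h1, C1, hC1⟩ := hb
  obtain ⟨B, hB⟩ := (isCompact_Icc (a := (0:ℝ)) (b := T)).exists_bound_of_continuousOn
    (hu.mono Set.Icc_subset_Ici_self)
  refine ⟨ContinuousOn.mul ?_ h1, B * C1, fun τ y ω e1 e2 e3 => ?_⟩
  · exact hu.comp (by fun_prop : ContinuousOn (fun z : ℝ × ℝ × ℝ => z.2.1) {z | 0 ≤ z.2.1})
      (fun z hz => hz)
  · have h3 := hB y ⟨e2, by linarith⟩
    rw [norm_mul, mul_assoc]
    exact mul_le_mul h3 (hC1 τ y ω e1 e2 e3) (norm_nonneg _) ((norm_nonneg _).trans h3)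

lemma aux_sym_w {m T : ℝ} {b : ℝ → ℝ → ℝ → ℂ} (hb : AuxSym m T b) (u : ℝ → ℂ)
    (hu : Continuous u) (B : ℝ) (hB : ∀ ω, ‖u ω‖ ≤ B) : AuxSym m T (fun τ y ω => u ω * b τ y ω) := by
  obtain ⟨h1, C1, hC1⟩ := hb
  refine ⟨ContinuousOn.mul ?_ h1, B * C1, fun τ y ω e1 e2 e3 => ?_⟩
  · exact (hu.comp (by fun_prop : Continuous (fun z : ℝ × ℝ × ℝ => z.2.2))).continuousOn
  · have h3 := hB ω
    rw [norm_mul, mul_assoc]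
    exact mul_le_mul h3 (hC1 τ y ω e1 e2 e3) (norm_nonneg _) ((norm_nonneg _).trans h3)

lemma auxW_bdd (K : ℝ) (hK : 0 < K) (a : ℝ → ℂ) (C : ℝ) (hC : 0 ≤ C)
    (h : ∀ ω, ‖a ω‖ ≤ C * (1 / 4 + ω^2)) (ω : ℝ) : ‖a ω * auxW K ω‖ ≤ C * √K := by
  rw [norm_mul, auxW_norm K hK]
  have h1 := auxQ_mul ω
  have h2 := auxQ_pos ω
  calc _ ≤ C * (1 / 4 + ω^2) * (√K * auxQ ω) := by
        exact mul_le_mul_of_nonneg_right (h ω) (by positivity)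
    _ = C * √K * (auxQ ω * (1 / 4 + ω^2)) := by ring
    _ ≤ C * √K * 1 := mul_le_mul_of_nonneg_left h1 (by positivity)
    _ = _ := mul_one _

lemma auxLam_norm (ω : ℝ) : ‖auxLam ω‖ ≤ 1 / 2 + |ω| := by
  unfold auxLam
  refine (norm_add_le _ _).trans ?_
  simp

lemma auxLam_norm' (ω : ℝ) : ‖auxLam ω - 1‖ ≤ 1 / 2 + |ω| := by
  have : auxLam ω - 1 = -(1 / 2) + ω * Complex.I := by unfold auxLam; ring
  rw [this]
  refine (norm_add_le _ _).trans ?_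
  simp

lemma aux_sq_bd (ω : ℝ) : 1 / 2 + |ω| ≤ 4 * (1 / 4 + ω^2) := by
  have := sq_abs ω
  nlinarith [sq_nonneg (|ω| - 1/4), abs_nonneg ω]

lemma aux_sq_bd' (ω : ℝ) : (1 / 2 + |ω|) * (1 / 2 + |ω|) ≤ 4 * (1 / 4 + ω^2) := by
  have := sq_abs ω
  nlinarith [sq_nonneg (|ω| - 1/2), abs_nonneg ω]

lemma auxLam_prod (ω : ℝ) : auxLam ω * (auxLam ω - 1) = ((-(1 / 4 + ω^2) : ℝ) : ℂ) := by
  unfold auxLam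
  push_cast
  linear_combination (ω : ℂ)^2 * Complex.I_sq

/-- Existence of a classical solution of at most linear growth. -/
lemma aux_exist {k : ℕ} (hk : 1 ≤ k) (T K : ℝ) (hT : 0 < T) (hK : 0 < K)
    (r σ : Fin k → ℝ) (hr : ∀ i, 0 ≤ r i) (hσ : ∀ i, 0 < σ i)
    (p : Fin k → Fin k → ℝ) (hp0 : ∀ i j, 0 ≤ p i j)
    (hp1 : ∀ i, ∑ j, p i j = 1) (hpd : ∀ i, p i i = 0)
    (f : Fin k → ℝ → ℝ)
    (F : Fin k → ℝ → ℝ)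
    (g g' G : Fin k → ℝ → ℝ) (hg' : ∀ i, Continuous (g' i))
    (hg : ∀ i x, HasDerivAt (g i) (g' i x) x) (hgf : ∀ i x, 0 ≤ x → g i x = f i x)
    (hg0 : ∀ i x, 0 ≤ x → 0 ≤ g i x)
    (hG : ∀ i y, G i y = ∫ u in (0:ℝ)..y, g i u)
    (hGd : ∀ i x, HasDerivAt (G i) (g i x) x)
    (hGF : ∀ i x, 0 ≤ x → G i x = F i x) (hG0 : ∀ i x, 0 ≤ x → 0 ≤ G i x)
    (hG1 : ∀ i x, 0 ≤ x → G i x < 1)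
    (ρ : ℝ) (hρ0 : 0 ≤ ρ) (hρ1 : ρ < 1) (hGρ : ∀ i τ, 0 ≤ τ → τ ≤ T → G i τ ≤ ρ) :
    ∃ φ : ℝ → ℝ → Fin k → ℝ → ℝ, IsClassicalSol r σ p f F K T φ ∧ LinGrowth T φ := by
  obtain ⟨i0, -, hi0⟩ := Finset.exists_min_image (Finset.univ : Finset (Fin k)) (fun i => σ i ^ 2)
    ⟨⟨0, hk⟩, Finset.mem_univ _⟩
  set m : ℝ := σ i0 ^ 2 / 2 with hmdef
  have hm : 0 < m := by have := hσ i0; positivity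
  have hmσ : ∀ i, 2 * m ≤ σ i ^ 2 := fun i => by
    have := hi0 i (Finset.mem_univ i)
    linarith
  have hgc : ∀ i, Continuous (g i) := fun i => continuous_iff_continuousAt.2 fun x => (hg i x).continuousAt
  have hGc : ∀ i, Continuous (G i) := fun i => continuous_iff_continuousAt.2 fun x => (hGd i x).continuousAt
  set c : ℝ → ℝ := fun ω => m * (1 / 4 + ω^2) with hcdef
  have hcc : Continuous c := by fun_prop
  have hc0 : ∀ ω, 0 < c ω := fun ω => by simp only [hcdef]; positivity
  set κ : Fin k → ℝ → ℂ := fun i ω =>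
    (r i : ℂ) * (auxLam ω - 1) + ((1 / 2 * σ i ^ 2 : ℝ) : ℂ) * (auxLam ω * (auxLam ω - 1)) with hκdef
  have hκc : ∀ i, Continuous (κ i) := fun i => by
    have := auxLam_cont
    simp only [hκdef]
    fun_prop
  have hκre : ∀ i ω, (κ i ω).re ≤ - c ω := by
    intro i ω
    simp only [hκdef, auxLam_prod, Complex.add_re, Complex.re_ofReal_mul, Complex.sub_re, auxLam_re,
      Complex.one_re, Complex.ofReal_re, hcdef]
    have h1 := mul_le_mul_of_nonneg_right (hmσ i) (by positivity : 0 ≤ 1 / 4 + ω^2)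
    have := hr i
    linarith
  have hκn : ∀ i ω, ‖κ i ω‖ ≤ (r i * 4 + 1 / 2 * σ i ^ 2) * (1 / 4 + ω^2) := by
    intro i ω
    simp only [hκdef]
    refine (norm_add_le _ _).trans ?_
    rw [auxLam_prod, norm_mul, norm_mul, Complex.norm_real, Complex.norm_real, Complex.norm_real,
      Real.norm_eq_abs, Real.norm_eq_abs, Real.norm_eq_abs, abs_neg, abs_of_nonneg (hr i),
      abs_of_nonneg (by positivity : 0 ≤ 1 / 2 * σ i ^ 2), abs_of_nonneg (by positivity : 0 ≤ 1 / 4 + ω^2),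
      add_mul]
    have h1 := mul_le_mul_of_nonneg_left ((auxLam_norm' ω).trans (aux_sq_bd ω)) (hr i)
    linarith
  obtain ⟨N, hNc, ⟨CN, hCN⟩, hN⟩ := aux_volterra T hT p hp0 hp1 g hgc hg0 G hG ρ hρ0 hρ1 hGρ κ hκc c hcc hκre
  set n : Fin k → ℝ → ℝ → ℂ := fun i w ω => ∑ j, (p i j : ℂ) * N j w ω with hndef
  have hnc : ∀ i, Continuous (fun z : ℝ × ℝ => n i z.1 z.2) := fun i =>
    continuous_finset_sum _ fun j _ => continuous_const.mul (hNc j)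
  have hnC : ∀ i w ω, ‖n i w ω‖ ≤ CN * Real.exp (- c ω * w) := by
    intro i w ω
    refine (norm_sum_le _ _).trans ?_
    calc _ ≤ ∑ j, p i j * (CN * Real.exp (- c ω * w)) := by
          refine Finset.sum_le_sum fun j _ => ?_
          rw [norm_mul, Complex.norm_real, Real.norm_eq_abs, abs_of_nonneg (hp0 i j)]
          exact mul_le_mul_of_nonneg_left (hCN j w ω) (hp0 i j)
      _ = _ := by rw [← Finset.sum_mul, hp1, one_mul]
  have hmodes : ∀ i, ∃ P Py : ℝ → ℝ → ℝ → ℂ,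
      Continuous (fun z : ℝ × ℝ × ℝ => P z.1 z.2.1 z.2.2) ∧
      Continuous (fun z : ℝ × ℝ × ℝ => Py z.1 z.2.1 z.2.2) ∧
      (∀ τ y ω, HasDerivAt (fun y => P τ y ω) (Py τ y ω) y) ∧
      (∀ τ y ω, HasDerivAt (fun τ => P τ y ω)
        (κ i ω * P τ y ω + Py τ y ω + (g i y : ℂ) * n i τ ω) τ) ∧
      (∀ y ω, P 0 y ω = ((1 - G i y : ℝ) : ℂ)) ∧
      (∀ τ ω, P τ 0 ω = ((1 - G i τ : ℝ) : ℂ) * Complex.exp (κ i ω * τ) +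
        ∫ w in (0:ℝ)..τ, (g i (τ - w) : ℂ) * Complex.exp (κ i ω * ((τ - w : ℝ) : ℂ)) * n i w ω) ∧
      (∃ C', ∀ τ y ω, 0 ≤ τ → 0 ≤ y → τ + y ≤ T → ‖P τ y ω‖ ≤ C' * Real.exp (- c ω * τ)) ∧
      (∃ C', ∀ τ y ω, 0 ≤ τ → 0 ≤ y → τ + y ≤ T → ‖Py τ y ω‖ ≤ C' * Real.exp (- c ω * τ)) := by
    intro i
    obtain ⟨B1, hB1⟩ := (isCompact_Icc (a := (0:ℝ)) (b := T)).exists_bound_of_continuousOn (hgc i).continuousOn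
    obtain ⟨B2, hB2⟩ := (isCompact_Icc (a := (0:ℝ)) (b := T)).exists_bound_of_continuousOn (hg' i).continuousOn
    refine aux_modes (g i) (g' i) (G i) (hg i) (hg' i) (hGd i) (κ i) (hκc i) (n i) (hnc i) T
      (|B1| + |B2| + 1) CN hT c ?_ ?_ ?_ (hκre i) (hnC i)
    · intro x h1 h2
      have := hB1 x ⟨h1, h2⟩
      rw [Real.norm_eq_abs] at this
      linarith [le_abs_self B1, abs_nonneg B2]
    · intro x h1 h2
      have := hB2 x ⟨h1, h2⟩
      rw [Real.norm_eq_abs] at this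
      linarith [le_abs_self B2, abs_nonneg B1]
    · intro x h1 h2
      rw [abs_of_pos (by linarith [hG1 i x h1])]
      linarith [hG0 i x h1, abs_nonneg B2, abs_nonneg B1]
  choose P Py hPc hPyc hPdy hPdt hP0 hPN hPb hPyb using hmodes
  have hPN' : ∀ i τ ω, 0 ≤ τ → τ ≤ T → P i τ 0 ω = N i τ ω := by
    intro i τ ω h1 h2
    rw [hPN i τ ω, hN i τ ω h1 h2]
  have hne : ∀ i y, 0 ≤ y → ((1 - G i y : ℝ) : ℂ) ≠ 0 := fun i y hy => by
    have := hG1 i y hy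
    exact_mod_cast (by linarith : 0 < 1 - G i y).ne'
  set v : Fin k → ℝ → ℂ := fun i y => (((1 - G i y : ℝ) : ℂ))⁻¹ with hvdef
  have hvc : ∀ i, ContinuousOn (v i) (Set.Ici 0) := by
    intro i
    refine ContinuousOn.inv₀ ?_ (fun y hy => hne i y hy)
    have := hGc i
    fun_prop
  have hgC : ∀ i, Continuous (fun y => (g i y : ℂ)) := fun i => Complex.continuous_ofReal.comp (hgc i)
  have hvd : ∀ i y, 0 ≤ y → HasDerivAt (v i) ((g i y : ℂ) * v i y ^ 2) y := by
    intro i y hy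
    have h1 : HasDerivAt (fun y => ((1 - G i y : ℝ) : ℂ)) ((- g i y : ℝ) : ℂ) y :=
      ((hGd i y).const_sub 1).ofReal_comp
    refine (HasDerivAt.fun_inv h1 (hne i y hy)).congr_deriv ?_
    simp only [hvdef]
    push_cast
    rw [inv_pow, neg_neg, div_eq_mul_inv]
  set W := auxW K with hW
  have hWc : Continuous W := auxW_cont K hK
  have hWb : ∀ ω, ‖W ω‖ ≤ 4 * √K := fun ω => by
    have := auxW_bdd K hK (fun _ => 1) 4 (by norm_num) (fun ω => by simp; nlinarith [sq_nonneg ω]) ω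
    simpa using this
  have sP : ∀ i, AuxSym m T (P i) := fun i => ⟨(hPc i).continuousOn, hPb i⟩
  have sPy : ∀ i, AuxSym m T (Py i) := fun i => ⟨(hPyc i).continuousOn, hPyb i⟩
  have sn : ∀ i, AuxSym m T (fun τ _ ω => n i τ ω) := fun i =>
    ⟨((hnc i).comp (by fun_prop : Continuous (fun z : ℝ × ℝ × ℝ => (z.1, z.2.2)))).continuousOn,
      CN, fun τ y ω _ _ _ => hnC i τ ω⟩
  have sM : ∀ i, AuxSym m T (fun τ y ω => v i y * P i τ y ω) := fun i => aux_sym_y (sP i) _ (hvc i)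
  have sN : ∀ i, AuxSym m T (fun τ y ω => (v i y * (g i y : ℂ)) * n i τ ω) := fun i =>
    aux_sym_y (sn i) _ ((hvc i).mul (hgC i).continuousOn)
  have sMy : ∀ i, AuxSym m T (fun τ y ω => v i y * Py i τ y ω + ((g i y : ℂ) * v i y ^ 2) * P i τ y ω) :=
    fun i => aux_sym_add (aux_sym_y (sPy i) _ (hvc i))
      (aux_sym_y (sP i) _ ((hgC i).continuousOn.mul ((hvc i).pow 2)))
  have hMb := fun i => (sM i).2
  choose CM hCM using hMb
  refine aux_solution T K m hT hK hm r σ p hp1 hpd f F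
    (fun i τ y ω => W ω * (v i y * P i τ y ω))
    (fun i τ y ω => W ω * (v i y * Py i τ y ω + ((g i y : ℂ) * v i y ^ 2) * P i τ y ω))
    (fun i τ y ω => (κ i ω * W ω) * (v i y * P i τ y ω) +
      W ω * (v i y * Py i τ y ω + (v i y * (g i y : ℂ)) * n i τ ω))
    (fun i => aux_sym_w (sM i) W hWc _ hWb)
    (fun i => aux_sym_w (sMy i) W hWc _ hWb)
    (fun i => aux_sym_add (aux_sym_w (sM i) _ ((hκc i).mul hWc) _
        (auxW_bdd K hK (κ i) _ (by have := hr i; positivity) (hκn i)))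
      (aux_sym_w (aux_sym_add (aux_sym_y (sPy i) _ (hvc i)) (sN i)) W hWc _ hWb))
    ?_ ?_ (√K * ∑ i, |CM i|) (by positivity) ?_ ?_ ?_ ?_ ?_
  · intro i
    have e : (fun τ y ω => (auxLam ω - (0 : ℕ)) * (W ω * (v i y * P i τ y ω)))
        = fun τ y ω => (auxLam ω * W ω) * (v i y * P i τ y ω) := by
      funext τ y ω
      push_cast
      ring
    rw [e]
    exact aux_sym_w (sM i) (fun ω => auxLam ω * W ω) (auxLam_cont.mul hWc) _
      (auxW_bdd K hK auxLam 4 (by norm_num) (fun ω => (auxLam_norm ω).trans (aux_sq_bd ω)))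
  · intro i
    have e : (fun τ y ω => (auxLam ω - (1 : ℕ)) * ((auxLam ω - (0 : ℕ)) * (W ω * (v i y * P i τ y ω))))
        = fun τ y ω => ((auxLam ω * (auxLam ω - 1)) * W ω) * (v i y * P i τ y ω) := by
      funext τ y ω
      push_cast
      ring
    rw [e]
    refine aux_sym_w (sM i) (fun ω => (auxLam ω * (auxLam ω - 1)) * W ω) ?_ _
      (auxW_bdd K hK (fun ω => auxLam ω * (auxLam ω - 1)) 1 (by norm_num) (fun ω => ?_))
    · have := auxLam_cont
      fun_prop
    · rw [auxLam_prod, Complex.norm_real, Real.norm_eq_abs, abs_neg, abs_of_nonneg (by positivity), one_mul]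
  · intro i τ y ω h1 h2 h3
    have a1 := hCM i τ y ω h1 h2 h3
    have a2 : Real.exp (- (m * (1 / 4 + ω^2)) * τ) ≤ 1 := by
      apply Real.exp_le_one_iff.2
      have : 0 ≤ m * (1 / 4 + ω^2) * τ := by positivity
      linarith
    have a3 : CM i * Real.exp (- (m * (1 / 4 + ω^2)) * τ) ≤ |CM i| := by
      calc _ ≤ |CM i| * 1 := mul_le_mul (le_abs_self _) a2 (Real.exp_nonneg _) (abs_nonneg _)
        _ = _ := mul_one _
    have a4 : |CM i| ≤ ∑ i, |CM i| :=
      Finset.single_le_sum (f := fun i => |CM i|) (fun j _ => abs_nonneg _) (Finset.mem_univ i)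
    rw [norm_mul, hW, auxW_norm K hK]
    have a5 := auxQ_pos ω
    calc _ ≤ √K * auxQ ω * ∑ i, |CM i| :=
          mul_le_mul_of_nonneg_left (a1.trans (a3.trans a4)) (by positivity)
      _ = _ := by ring
  · intro i τ y ω hy
    refine ((HasDerivAt.fun_mul (hvd i y hy.le) (hPdy i τ y ω)).const_mul (W ω)).congr_deriv ?_
    ring
  · intro i τ y ω hy
    refine (((hPdt i τ y ω).const_mul (v i y)).const_mul (W ω)).congr_deriv ?_
    ring
  · intro i y ω hy
    simp only [hP0, hvdef]
    rw [inv_mul_cancel₀ (hne i y hy), mul_one]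
  · intro i τ y ω hy hτ hτy
    have e1 : ∀ j, v j 0 * P j τ 0 ω = N j τ ω := by
      intro j
      have : G j 0 = 0 := by rw [hG]; simp
      simp only [hvdef, this, hPN' j τ ω hτ (by linarith)]
      simp
    have e2 : ((f i y / (1 - F i y) : ℝ) : ℂ) = (g i y : ℂ) * v i y := by
      rw [← hgf i y hy.le, ← hGF i y hy.le]
      simp only [hvdef]
      push_cast
      rw [div_eq_mul_inv]
    have e3 : ∑ j, (p i j : ℂ) * (W ω * (v j 0 * P j τ 0 ω)) = W ω * n i τ ω := by
      simp only [hndef, e1, Finset.mul_sum]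
      exact Finset.sum_congr rfl fun j _ => by ring
    rw [e2, e3]
    simp only [hκdef]
    ring
/-- The initial-boundary value problem has exactly one classical solution in the
class of functions with at most linear growth. -/
theorem pde_existence_uniqueness
    (k : ℕ) (hk : 1 ≤ k) (T K : ℝ) (hT : 0 < T) (hK : 0 < K)
    (r σ : Fin k → ℝ) (hr : ∀ i, 0 ≤ r i) (hσ : ∀ i, 0 < σ i)
    (p : Fin k → Fin k → ℝ) (hp0 : ∀ i j, 0 ≤ p i j)
    (hp1 : ∀ i, ∑ j, p i j = 1) (hpd : ∀ i, p i i = 0)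
    (f : Fin k → ℝ → ℝ)
    (hfC1 : ∀ i, ContDiffOn ℝ 1 (f i) (Set.Ici 0))
    (hfbd : ∀ i, ∃ M : ℝ, ∀ y, 0 ≤ y → f i y ≤ M)
    (hfpos : ∀ i y, 0 < y → 0 < f i y)
    (hfnn : ∀ i y, 0 ≤ y → 0 ≤ f i y)
    (hfdens : ∀ i, ∫ u in Set.Ioi (0 : ℝ), f i u = 1)
    (F : Fin k → ℝ → ℝ) (hFdef : ∀ i y, F i y = ∫ u in (0 : ℝ)..y, f i u)
    (hFlt : ∀ i y, 0 ≤ y → F i y < 1)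
    (hirr : ∀ i j : Fin k, ∃ n : ℕ, 0 < n ∧ 0 < ((Matrix.of p) ^ n) i j) :
    ∃ φ : ℝ → ℝ → Fin k → ℝ → ℝ,
      (IsClassicalSol r σ p f F K T φ ∧ LinGrowth T φ) ∧
      ∀ ψ : ℝ → ℝ → Fin k → ℝ → ℝ,
        IsClassicalSol r σ p f F K T ψ → LinGrowth T ψ →
        ∀ t s y : ℝ, (t, s, y) ∈ domDbar T → ∀ i, ψ t s i y = φ t s i y := by
  choose g g' hg'c hg hgf using fun i => aux_extend (f i) (hfC1 i)
  have hgc : ∀ i, Continuous (g i) := fun i =>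
    continuous_iff_continuousAt.2 fun x => (hg i x).continuousAt
  have hg0 : ∀ i x, 0 ≤ x → 0 ≤ g i x := fun i x hx => by
    rw [hgf i x hx]; exact hfnn i x hx
  have hGd : ∀ i x, HasDerivAt (fun y => ∫ u in (0:ℝ)..y, g i u) (g i x) x := fun i x =>
    ((hgc i).integral_hasStrictDerivAt 0 x).hasDerivAt
  have hGF : ∀ i x, 0 ≤ x → (∫ u in (0:ℝ)..x, g i u) = F i x := fun i x hx => by
    rw [hFdef]
    apply intervalIntegral.integral_congr
    intro u hu
    rw [Set.uIcc_of_le hx] at hu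
    exact hgf i u hu.1
  have hG0 : ∀ i x, 0 ≤ x → 0 ≤ ∫ u in (0:ℝ)..x, g i u := fun i x hx =>
    intervalIntegral.integral_nonneg hx fun u hu => hg0 i u hu.1
  have hG1 : ∀ i x, 0 ≤ x → (∫ u in (0:ℝ)..x, g i u) < 1 := fun i x hx => by
    rw [hGF i x hx]; exact hFlt i x hx
  have hmono : ∀ i x, 0 ≤ x → x ≤ T → F i x ≤ F i T := fun i x hx hxT => by
    rw [← hGF i x hx, ← hGF i T hT.le]
    have h1 := intervalIntegral.integral_add_adjacent_intervals
      ((hgc i).intervalIntegrable (μ := volume) 0 x) ((hgc i).intervalIntegrable (μ := volume) x T)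
    have h2 : 0 ≤ ∫ u in x..T, g i u :=
      intervalIntegral.integral_nonneg hxT fun u hu => hg0 i u (hx.trans hu.1)
    linarith
  obtain ⟨i0, -, hi0⟩ := Finset.exists_max_image (Finset.univ : Finset (Fin k))
    (fun i => F i T) ⟨⟨0, hk⟩, Finset.mem_univ _⟩
  have hρ : ∀ i x, 0 ≤ x → x ≤ T → F i x ≤ F i0 T := fun i x hx hxT =>
    (hmono i x hx hxT).trans (hi0 i (Finset.mem_univ i))
  have hρ1 : F i0 T < 1 := hFlt i0 T hT.le
  have hρ0 : 0 ≤ F i0 T := by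
    rw [← hGF i0 T hT.le]; exact hG0 i0 T hT.le
  choose M hM using hfbd
  have hpos : ∀ i y, 0 < y → y < T → 0 < 1 - F i y := fun i y hy hyT => by
    have := hFlt i y hy.le
    linarith
  have hh0 : ∀ i y, 0 < y → y < T → 0 ≤ f i y / (1 - F i y) := fun i y hy hyT =>
    div_nonneg (hfnn i y hy.le) (hpos i y hy hyT).le
  have hhH : ∀ i y, 0 < y → y < T →
      f i y / (1 - F i y) ≤ (∑ j, |M j|) / (1 - F i0 T) := fun i y hy hyT => by
    have h1 : f i y ≤ ∑ j, |M j| := ((hM i y hy.le).trans (le_abs_self _)).trans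
      (Finset.single_le_sum (f := fun j => |M j|) (fun j _ => abs_nonneg _) (Finset.mem_univ i))
    have h2 := hρ i y hy.le hyT.le
    exact div_le_div₀ (Finset.sum_nonneg fun j _ => abs_nonneg _) h1 (by linarith) (by linarith)
  have hH : 0 ≤ (∑ j, |M j|) / (1 - F i0 T) :=
    div_nonneg (Finset.sum_nonneg fun j _ => abs_nonneg _) (by linarith)
  obtain ⟨φ, hφ, hφl⟩ := aux_exist hk T K hT hK r σ hr hσ p hp0 hp1 hpd f F g g'
    (fun i y => ∫ u in (0:ℝ)..y, g i u) hg'c hg hgf hg0 (fun _ _ => rfl) hGd hGF hG0 hG1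
    (F i0 T) hρ0 hρ1 (fun i τ h0 h1 => by
      have := hρ i τ h0 h1
      rw [← hGF i τ h0] at this
      exact this)
  refine ⟨φ, ⟨hφ, hφl⟩, fun ψ hψ hψl t s y hq i => ?_⟩
  have h1 := aux_unique T K hT r σ hr p hp0 hp1 f F _ hh0 hhH hH φ ψ hφ hφl hψ hψl t s y hq i
  have h2 := aux_unique T K hT r σ hr p hp0 hp1 f F _ hh0 hhH hH ψ φ hψ hψl hφ hφl t s y hq i
  linarith
end

section
/- Let φ be the unique continuous non-negative solution with at most linear growth of the Volterra integral equation φ(t,s,i,y) = ((1−F(T−t+y|i))/(1−F(y|i))) η_i(t,s) + ∫₀^{T−t} e^{−r(i)v} (f(y+v|i)/(1−F(y|i))) Σ_j p_{ij} ∫₀^∞ φ(t+v,x,j,0) α(x;s,i,v) dx dv, φ(t,0,i,y) = 0. Then on D the partial derivative of φ with respect to s admits the integral representation ∂φ/∂s(t,s,i,y) = ((1−F(T−t+y|i))/(1−F(y|i))) ∂η_i/∂s(t,s) + ∫₀^{T−t} e^{−r(i)v} (f(y+v|i)/(1−F(y|i))) Σ_j p_{ij} ∫₀^∞ φ(t+v,x,j,0)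 α(x;s,i,v) · (1/s) · (ln(x/s) − (r(i)−σ(i)²/2)v)/(σ(i)²v) dx dv. -/
open MeasureTheory Real Set Finset

lemma key_bound {C a c B D d z h : ℝ} (hC : 0 ≤ C) (hc : 0 < c) (hB : c ≤ B) (hd : |d| ≤ D)
    (hh : |h| ≤ C * (1 + Real.exp (a + c * z))) :
    |h| * (1 + |z - d|) * Real.exp (-(z - d) ^ 2 / 2) ≤
      C * (1 + Real.exp a) * Real.exp (D + (B + 1 + D) ^ 2) * Real.exp (-z ^ 2 / 4) := by
  have hz := abs_nonneg z
  have hD : 0 ≤ D := le_trans (abs_nonneg d) hd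
  have h1 : |h| ≤ C * ((1 + Real.exp a) * Real.exp (B * |z|)) := by
    refine hh.trans (mul_le_mul_of_nonneg_left ?_ hC)
    have e1 : c * z ≤ B * |z| :=
      (mul_le_mul_of_nonneg_left (le_abs_self z) hc.le).trans
        (mul_le_mul_of_nonneg_right hB hz)
    have e2 : Real.exp (c * z) ≤ Real.exp (B * |z|) := Real.exp_le_exp.mpr e1
    have e3 : 1 ≤ Real.exp (B * |z|) :=
      Real.one_le_exp (mul_nonneg (hc.le.trans hB) hz)
    rw [Real.exp_add]
    nlinarith [Real.exp_pos a]
  have h2 : 1 + |z - d| ≤ Real.exp (|z| + D) := by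
    have := Real.add_one_le_exp (|z| + D)
    have := abs_sub z d
    linarith
  have h3 : Real.exp (-(z - d) ^ 2 / 2) ≤ Real.exp (-z ^ 2 / 2 + D * |z|) := by
    apply Real.exp_le_exp.mpr
    have : z * d ≤ |z| * D := (le_abs_self _).trans (by
      rw [abs_mul]; exact mul_le_mul_of_nonneg_left hd hz)
    nlinarith [sq_nonneg d]
  calc |h| * (1 + |z - d|) * Real.exp (-(z - d) ^ 2 / 2)
      ≤ (C * ((1 + Real.exp a) * Real.exp (B * |z|))) * Real.exp (|z| + D)
          * Real.exp (-z ^ 2 / 2 + D * |z|) := by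
        gcongr
    _ = C * (1 + Real.exp a) * Real.exp (B * |z| + (|z| + D) + (-z ^ 2 / 2 + D * |z|)) := by
        rw [Real.exp_add (B * |z| + _), Real.exp_add (B * |z|)]; ring
    _ ≤ C * (1 + Real.exp a) * Real.exp (D + (B + 1 + D) ^ 2 + -z ^ 2 / 4) := by
        have := Real.exp_pos a
        refine mul_le_mul_of_nonneg_left (Real.exp_le_exp.mpr ?_) (by positivity)
        have : z ^ 2 = |z| ^ 2 := (sq_abs z).symm
        rw [this]
        nlinarith [sq_nonneg (|z| / 2 - (B + 1 + D))]
    _ = _ := by rw [Real.exp_add (D + _)]; ring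

lemma integrable_gauss4 : Integrable (fun z : ℝ => Real.exp (-z ^ 2 / 4)) := by
  have := integrable_exp_neg_mul_sq (b := 1/4) (by norm_num)
  refine this.congr (Filter.Eventually.of_forall fun z => ?_)
  simp only []
  congr 1; ring

lemma integrable_gauss4' (a c : ℝ) (hc : 0 < c) :
    Integrable (fun u : ℝ => Real.exp (-((u - a) / c) ^ 2 / 4)) :=
  (integrable_gauss4.comp_div hc.ne').comp_sub_right a

lemma G_bound {C a c B : ℝ} {h : ℝ → ℝ} (hC : 0 ≤ C) (hc : 0 < c) (hB : c ≤ B)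
    (hh : ∀ u, |h u| ≤ C * (1 + Real.exp u)) {Q : ℝ → ℝ} (hQ : ∀ z, |Q z| ≤ 1 + |z|) :
    |∫ u, h u * Real.exp (-((u - a) / c) ^ 2 / 2) * Q ((u - a) / c)| ≤
      c * (C * (1 + Real.exp a) * Real.exp ((B + 1) ^ 2) * ∫ z : ℝ, Real.exp (-z ^ 2 / 4)) := by
  have e1 : ∫ u, h u * Real.exp (-((u - a) / c) ^ 2 / 2) * Q ((u - a) / c)
      = c * ∫ z, h (a + c * z) * Real.exp (-z ^ 2 / 2) * Q z := by
    have := integral_sub_right_eq_self (μ := volume)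
      (fun u => h (a + u) * Real.exp (-(u / c) ^ 2 / 2) * Q (u / c)) a
    simp only [add_sub_cancel] at this
    rw [this]
    have := Measure.integral_comp_div
      (fun z => h (a + c * z) * Real.exp (-z ^ 2 / 2) * Q z) c
    rw [abs_of_pos hc, smul_eq_mul] at this
    rw [← this]
    congr 1; ext u
    rw [mul_div_cancel₀ _ hc.ne']
  rw [e1, abs_mul, abs_of_pos hc]
  refine mul_le_mul_of_nonneg_left ?_ hc.le
  rw [← integral_const_mul, ← Real.norm_eq_abs]
  refine norm_integral_le_of_norm_le (integrable_gauss4.const_mul _)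
    (Filter.Eventually.of_forall fun z => ?_)
  have := key_bound (d := 0) (D := 0) hC hc hB (by simp) (hh (a + c * z)) (z := z)
  simp only [sub_zero, zero_add, add_zero] at this
  refine le_trans ?_ this
  rw [norm_mul, norm_mul, Real.norm_eq_abs, Real.norm_eq_abs, Real.norm_eq_abs,
    abs_of_pos (Real.exp_pos _), mul_right_comm]
  gcongr
  exact hQ z

lemma G_deriv {C c : ℝ} {h : ℝ → ℝ} (hC : 0 ≤ C) (hc : 0 < c) (hcont : Continuous h)
    (hh : ∀ u, |h u| ≤ C * (1 + Real.exp u)) (a₀ : ℝ) :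
    HasDerivAt (fun a => ∫ u, h u * Real.exp (-((u - a) / c) ^ 2 / 2))
      (∫ u, h u * Real.exp (-((u - a₀) / c) ^ 2 / 2) * ((u - a₀) / c ^ 2)) a₀ := by
  have kb : ∀ a ∈ Metric.ball a₀ 1, ∀ u,
      |h u| * (1 + |(u - a) / c|) * Real.exp (-((u - a) / c) ^ 2 / 2) ≤
      C * (1 + Real.exp a₀) * Real.exp (1 / c + (c + 1 + 1 / c) ^ 2) *
        Real.exp (-((u - a₀) / c) ^ 2 / 4) := by
    intro a ha u
    have hd : |(a - a₀) / c| ≤ 1 / c := by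
      rw [abs_div, abs_of_pos hc]
      have := (Metric.mem_ball.mp ha).le
      rw [Real.dist_eq] at this
      gcongr
    have := key_bound (z := (u - a₀) / c) (a := a₀) (h := h u) hC hc le_rfl hd (by
      rw [mul_div_cancel₀ _ hc.ne', add_sub_cancel]; exact hh u)
    have e : (u - a₀) / c - (a - a₀) / c = (u - a) / c := by ring
    rwa [e] at this
  refine (hasDerivAt_integral_of_dominated_loc_of_deriv_le
    (F := fun a u => h u * Real.exp (-((u - a) / c) ^ 2 / 2))
    (F' := fun a u => h u * Real.exp (-((u - a) / c) ^ 2 / 2) * ((u - a) / c ^ 2))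
    (bound := fun u => (1 / c) * (C * (1 + Real.exp a₀) * Real.exp (1 / c + (c + 1 + 1 / c) ^ 2) *
        Real.exp (-((u - a₀) / c) ^ 2 / 4)))
    (Metric.ball_mem_nhds a₀ one_pos) ?_ ?_ ?_ ?_ ?_ ?_).2
  · exact Filter.Eventually.of_forall fun a => by
      apply Continuous.aestronglyMeasurable; fun_prop
  · refine ((integrable_gauss4' a₀ c hc).const_mul
      (C * (1 + Real.exp a₀) * Real.exp (1 / c + (c + 1 + 1 / c) ^ 2))).mono'
      (by apply Continuous.aestronglyMeasurable; fun_prop)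
      (Filter.Eventually.of_forall fun u => ?_)
    refine le_trans ?_ (kb a₀ (Metric.mem_ball_self one_pos) u)
    rw [norm_mul, Real.norm_eq_abs, Real.norm_eq_abs, abs_of_pos (Real.exp_pos _)]
    gcongr
    nlinarith [abs_nonneg (h u), abs_nonneg ((u - a₀) / c)]
  · apply Continuous.aestronglyMeasurable; fun_prop
  · refine Filter.Eventually.of_forall fun u a ha => ?_
    refine le_trans ?_ (mul_le_mul_of_nonneg_left (kb a ha u) (by positivity))
    have e : (u - a) / c ^ 2 = (1 / c) * ((u - a) / c) := by field_simp
    rw [e, norm_mul, norm_mul, norm_mul, Real.norm_eq_abs, Real.norm_eq_abs, Real.norm_eq_abs,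
      Real.norm_eq_abs, abs_of_pos (Real.exp_pos _), abs_of_pos (by positivity : 0 < 1 / c)]
    have := mul_nonneg (abs_nonneg (h u)) (Real.exp_pos (-((u - a) / c) ^ 2 / 2)).le
    have : 0 < 1 / c := by positivity
    have : 0 ≤ 1 / c * (|h u| * Real.exp (-((u - a) / c) ^ 2 / 2)) := by positivity
    nlinarith
  · exact ((integrable_gauss4' a₀ c hc).const_mul _).const_mul _
  · refine Filter.Eventually.of_forall fun u a ha => ?_
    have h0 : HasDerivAt (fun a => -((u - a) / c) ^ 2 / 2) ((u - a) / c ^ 2) a := by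
      have := (((((hasDerivAt_id a).const_sub u).div_const c).pow 2).neg).div_const 2
      refine this.congr_deriv ?_
      simp; field_simp
    exact (h0.exp.const_mul (h u)).congr_deriv (by ring)

lemma int_exp (g : ℝ → ℝ) : ∫ x in Set.Ioi (0 : ℝ), g x = ∫ u, g (Real.exp u) * Real.exp u := by
  have := integral_image_eq_integral_abs_deriv_smul (s := Set.univ) (f := Real.exp)
    (f' := Real.exp) MeasurableSet.univ (fun x _ => (Real.hasDerivAt_exp x).hasDerivWithinAt)
    Real.exp_injective.injOn g
  rw [Set.image_univ, Real.range_exp] at this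
  rw [this, setIntegral_univ]
  congr 1; ext u
  rw [abs_of_pos (Real.exp_pos _), smul_eq_mul, mul_comm]

lemma lnK_exp {r σ w v u : ℝ} (hσ : 0 < σ) (hw : 0 < w) (hv : 0 < v) :
    lnKernel r σ (Real.exp u) w v * Real.exp u =
      (Real.sqrt (2 * Real.pi) * (σ * √v))⁻¹ *
      Real.exp (-((u - (Real.log w + (r - σ ^ 2 / 2) * v)) / (σ * √v)) ^ 2 / 2) := by
  unfold lnKernel lnL
  rw [Real.log_div (Real.exp_pos u).ne' hw.ne', Real.log_exp, sub_sub]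
  have := Real.exp_pos u
  have := Real.sqrt_pos.mpr hv
  have : 0 < Real.sqrt (2 * Real.pi) := by positivity
  field_simp

lemma H_eq {r σ w v : ℝ} (hσ : 0 < σ) (hw : 0 < w) (hv : 0 < v) (g : ℝ → ℝ) :
    ∫ x in Set.Ioi (0 : ℝ), g x * lnKernel r σ x w v =
      (Real.sqrt (2 * Real.pi) * (σ * √v))⁻¹ * ∫ u, g (Real.exp u) *
      Real.exp (-((u - (Real.log w + (r - σ ^ 2 / 2) * v)) / (σ * √v)) ^ 2 / 2) := by
  rw [int_exp, ← integral_const_mul]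
  congr 1; ext u
  rw [mul_assoc, lnK_exp hσ hw hv]; ring

lemma H'_eq {r σ w v : ℝ} (hσ : 0 < σ) (hw : 0 < w) (hv : 0 < v) (g : ℝ → ℝ) :
    ∫ x in Set.Ioi (0 : ℝ), g x * lnKernel r σ x w v *
        ((1 / w) * ((Real.log (x / w) - (r - σ ^ 2 / 2) * v) / (σ ^ 2 * v))) =
      (Real.sqrt (2 * Real.pi) * (σ * √v))⁻¹ * ((∫ u, g (Real.exp u) *
      Real.exp (-((u - (Real.log w + (r - σ ^ 2 / 2) * v)) / (σ * √v)) ^ 2 / 2)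
       * ((u - (Real.log w + (r - σ ^ 2 / 2) * v)) / (σ * √v) ^ 2)) * w⁻¹) := by
  rw [int_exp, ← integral_mul_const, ← integral_const_mul]
  congr 1; ext u
  have e : (Real.log (Real.exp u / w) - (r - σ ^ 2 / 2) * v) / (σ ^ 2 * v)
      = (u - (Real.log w + (r - σ ^ 2 / 2) * v)) / (σ * √v) ^ 2 := by
    rw [Real.log_div (Real.exp_pos u).ne' hw.ne', Real.log_exp, sub_sub, mul_pow,
      Real.sq_sqrt hv.le]
  rw [e]
  have := lnK_exp (r := r) (u := u) hσ hw hv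
  calc _ = g (Real.exp u) * (lnKernel r σ (Real.exp u) w v * Real.exp u) * (1 / w *
        ((u - (Real.log w + (r - σ ^ 2 / 2) * v)) / (σ * √v) ^ 2)) := by ring
    _ = _ := by rw [this]; ring

/-- Derivative of the inner integral. -/
lemma H_deriv {C r σ w v : ℝ} (hC : 0 ≤ C) (hσ : 0 < σ) (hw : 0 < w) (hv : 0 < v) {g : ℝ → ℝ}
    (hg : ContinuousOn g (Set.Ioi 0)) (hb : ∀ x, 0 < x → |g x| ≤ C * (1 + x)) :
    HasDerivAt (fun w => ∫ x in Set.Ioi (0 : ℝ), g x * lnKernel r σ x w v)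
      (∫ x in Set.Ioi (0 : ℝ), g x * lnKernel r σ x w v *
        ((1 / w) * ((Real.log (x / w) - (r - σ ^ 2 / 2) * v) / (σ ^ 2 * v)))) w := by
  rw [H'_eq hσ hw hv]
  have hc : 0 < σ * √v := mul_pos hσ (Real.sqrt_pos.mpr hv)
  have h1 := G_deriv (h := fun u => g (Real.exp u)) hC hc
    (hg.comp_continuous Real.continuous_exp (fun u => Real.exp_pos u))
    (fun u => hb _ (Real.exp_pos u)) (Real.log w + (r - σ ^ 2 / 2) * v)
  have h2 : HasDerivAt (fun w => Real.log w + (r - σ ^ 2 / 2) * v) w⁻¹ w :=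
    (Real.hasDerivAt_log hw.ne').add_const _
  have h3 := (h1.comp w h2).const_mul (Real.sqrt (2 * Real.pi) * (σ * √v))⁻¹
  refine h3.congr_of_eventuallyEq ?_
  filter_upwards [lt_mem_nhds hw] with x hx
  rw [H_eq hσ hx hv]; rfl

/-- Uniform bounds of the inner integral and its derivative. -/
lemma H_bounds {C r σ s V : ℝ} (hC : 0 ≤ C) (hσ : 0 < σ) (hs : 0 < s) :
    ∃ A : ℝ, 0 ≤ A ∧ ∀ g : ℝ → ℝ, (∀ x, 0 < x → |g x| ≤ C * (1 + x)) →
      ∀ v, 0 < v → v < V → ∀ w ∈ Set.Ioo (s / 2) (2 * s),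
      |∫ x in Set.Ioi (0 : ℝ), g x * lnKernel r σ x w v| ≤ A ∧
      |∫ x in Set.Ioi (0 : ℝ), g x * lnKernel r σ x w v *
        ((1 / w) * ((Real.log (x / w) - (r - σ ^ 2 / 2) * v) / (σ ^ 2 * v)))| ≤ A * (√v)⁻¹ := by
  set J := ∫ z : ℝ, Real.exp (-z ^ 2 / 4) with hJ
  have hJ0 : 0 ≤ J := integral_nonneg fun z => (Real.exp_pos _).le
  set E := C * (1 + 2 * s * Real.exp (|r - σ ^ 2 / 2| * V)) * Real.exp ((σ * √V + 1) ^ 2) * J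
    with hE
  have hE0 : 0 ≤ E := by positivity
  have hp : 0 < Real.sqrt (2 * Real.pi) := by positivity
  have key : ∀ g : ℝ → ℝ, (∀ x, 0 < x → |g x| ≤ C * (1 + x)) →
      ∀ v, 0 < v → v < V → ∀ w ∈ Set.Ioo (s / 2) (2 * s), ∀ Q : ℝ → ℝ, (∀ z, |Q z| ≤ 1 + |z|) →
      |∫ u, g (Real.exp u) *
      Real.exp (-((u - (Real.log w + (r - σ ^ 2 / 2) * v)) / (σ * √v)) ^ 2 / 2) *
        Q ((u - (Real.log w + (r - σ ^ 2 / 2) * v)) / (σ * √v))| ≤ (σ * √v) * E := by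
    intro g hg v hv hvV w hw Q hQ
    have hw0 : 0 < w := by have := hw.1; linarith
    have hc : 0 < σ * √v := mul_pos hσ (Real.sqrt_pos.mpr hv)
    refine (G_bound (h := fun u => g (Real.exp u)) (B := σ * √V) hC hc (by gcongr)
      (fun u => hg _ (Real.exp_pos u)) hQ).trans ?_
    rw [hE, ← hJ]
    have : Real.exp (Real.log w + (r - σ ^ 2 / 2) * v) ≤
        2 * s * Real.exp (|r - σ ^ 2 / 2| * V) := by
      rw [Real.exp_add, Real.exp_log hw0]
      have h1 : (r - σ ^ 2 / 2) * v ≤ |r - σ ^ 2 / 2| * V :=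
        (mul_le_mul_of_nonneg_right (le_abs_self _) hv.le).trans
          (mul_le_mul_of_nonneg_left hvV.le (abs_nonneg _))
      have := hw.2.le
      gcongr
    gcongr
  refine ⟨E * (Real.sqrt (2 * Real.pi))⁻¹ + E * (Real.sqrt (2 * Real.pi))⁻¹ * σ⁻¹ * (s / 2)⁻¹,
    by positivity, ?_⟩
  intro g hg v hv hvV w hw
  have hw0 : 0 < w := by have := hw.1; linarith
  have hsv := Real.sqrt_pos.mpr hv
  have hc : 0 < σ * √v := mul_pos hσ hsv
  constructor
  · rw [H_eq hσ hw0 hv, abs_mul, abs_of_pos (by positivity)]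
    have h1 := key g hg v hv hvV w hw (fun _ => 1) (fun z => by simp)
    simp only [mul_one] at h1
    calc _ ≤ (Real.sqrt (2 * Real.pi) * (σ * √v))⁻¹ * ((σ * √v) * E) := by gcongr
      _ = E * (Real.sqrt (2 * Real.pi))⁻¹ := by field_simp
      _ ≤ _ := le_add_of_nonneg_right (by positivity)
  · rw [H'_eq hσ hw0 hv, abs_mul, abs_of_pos (by positivity), abs_mul,
      abs_of_pos (by positivity : 0 < w⁻¹)]
    have h1 := key g hg v hv hvV w hw (fun z => z) (fun z => by simp)
    have h2 : ∀ u, g (Real.exp u) *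
      Real.exp (-((u - (Real.log w + (r - σ ^ 2 / 2) * v)) / (σ * √v)) ^ 2 / 2)
       * ((u - (Real.log w + (r - σ ^ 2 / 2) * v)) / (σ * √v) ^ 2) =
       (σ * √v)⁻¹ * (g (Real.exp u) *
      Real.exp (-((u - (Real.log w + (r - σ ^ 2 / 2) * v)) / (σ * √v)) ^ 2 / 2)
       * ((u - (Real.log w + (r - σ ^ 2 / 2) * v)) / (σ * √v))) := by
      intro u
      generalize Real.exp _ = q
      field_simp
    simp_rw [h2]
    rw [integral_const_mul, abs_mul, abs_of_pos (by positivity : 0 < (σ * √v)⁻¹)]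
    have hwi : w⁻¹ ≤ (s / 2)⁻¹ := by have := hw.1.le; gcongr
    calc _ ≤ (Real.sqrt (2 * Real.pi) * (σ * √v))⁻¹ *
          ((σ * √v)⁻¹ * ((σ * √v) * E) * (s / 2)⁻¹) := by gcongr
      _ = E * (Real.sqrt (2 * Real.pi))⁻¹ * σ⁻¹ * (s / 2)⁻¹ * (√v)⁻¹ := by field_simp
      _ ≤ _ := by
        gcongr
        exact le_add_of_nonneg_left (by positivity)

lemma diff_cdf : Differentiable ℝ stdNormalCDF := by
  have hc : Continuous (fun u : ℝ => Real.exp (-u ^ 2 / 2) / Real.sqrt (2 * Real.pi)) := by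
    fun_prop
  have hi : Integrable (fun u : ℝ => Real.exp (-u ^ 2 / 2) / Real.sqrt (2 * Real.pi)) := by
    have := integrable_exp_neg_mul_sq (b := 1/2) (by norm_num)
    refine (this.congr (Filter.Eventually.of_forall fun z => ?_)).div_const _
    simp only []
    congr 1; ring
  have e : stdNormalCDF = fun x => stdNormalCDF 0 +
      ∫ u in (0:ℝ)..x, Real.exp (-u ^ 2 / 2) / Real.sqrt (2 * Real.pi) := by
    ext x
    have := intervalIntegral.integral_Iic_sub_Iic (μ := volume) (a := 0) (b := x)
      hi.integrableOn hi.integrableOn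
    rw [← this]; simp [stdNormalCDF]
  intro x
  rw [e]
  exact ((hc.integral_hasStrictDerivAt 0 x).hasDerivAt.differentiableAt).const_add _

lemma diff_bs {r σ K T t s : ℝ} (hσ : 0 < σ) (hK : 0 < K) (ht : t < T) (hs : 0 < s) :
    DifferentiableAt ℝ (fun w => bsPrice r σ K T t w) s := by
  have : (fun w => bsPrice r σ K T t w) =ᶠ[nhds s] fun s =>
      s * stdNormalCDF ((Real.log (s / K) + (r + σ ^ 2 / 2) * (T - t)) / (σ * Real.sqrt (T - t)))
      - K * Real.exp (-r * (T - t)) *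
        stdNormalCDF ((Real.log (s / K) + (r + σ ^ 2 / 2) * (T - t)) / (σ * Real.sqrt (T - t))
          - σ * Real.sqrt (T - t)) := by
    filter_upwards [lt_mem_nhds hs] with x hx
    simp [bsPrice, not_le.mpr hx, ht]
  refine DifferentiableAt.congr_of_eventuallyEq ?_ this
  have h1 : DifferentiableAt ℝ (fun s => (Real.log (s / K) + (r + σ ^ 2 / 2) * (T - t)) /
      (σ * Real.sqrt (T - t))) s := by
    have : s / K ≠ 0 := by positivity
    fun_prop (disch := assumption)
  have h2 := (diff_cdf _).comp s h1
  have h3 := (diff_cdf _).comp s (h1.sub_const (σ * Real.sqrt (T - t)))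
  exact (differentiableAt_id.mul h2).sub (h3.const_mul _)
/-- Integral representation of the partial derivative in `s` of the unique
solution of the Volterra integral equation. -/
theorem hedging_integral_representation
    (k : ℕ) (hk : 1 ≤ k) (T K : ℝ) (hT : 0 < T) (hK : 0 < K)
    (r σ : Fin k → ℝ) (hr : ∀ i, 0 ≤ r i) (hσ : ∀ i, 0 < σ i)
    (p : Fin k → Fin k → ℝ) (hp0 : ∀ i j, 0 ≤ p i j)
    (hp1 : ∀ i, ∑ j, p i j = 1) (hpd : ∀ i, p i i = 0)
    (f : Fin k → ℝ → ℝ)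
    (hfC1 : ∀ i, ContDiffOn ℝ 1 (f i) (Set.Ici 0))
    (hfbd : ∀ i, ∃ M : ℝ, ∀ y, 0 ≤ y → f i y ≤ M)
    (hfpos : ∀ i y, 0 < y → 0 < f i y)
    (hfnn : ∀ i y, 0 ≤ y → 0 ≤ f i y)
    (hfdens : ∀ i, ∫ u in Set.Ioi (0 : ℝ), f i u = 1)
    (F : Fin k → ℝ → ℝ) (hFdef : ∀ i y, F i y = ∫ u in (0 : ℝ)..y, f i u)
    (hFlt : ∀ i y, 0 ≤ y → F i y < 1)
    (φ : ℝ → ℝ → Fin k → ℝ → ℝ)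
    (hφc : ContOnClosure T φ) (hφg : LinGrowth T φ)
    (hφnn : ∀ t s y : ℝ, (t, s, y) ∈ domDbar T → ∀ i, 0 ≤ φ t s i y)
    (hφIE : SolvesIE r σ p f F K T φ) :
    ∀ t s y : ℝ, (t, s, y) ∈ domD T → ∀ i,
      HasDerivAt (fun w => φ t w i y)
        ((1 - F i (T - t + y)) / (1 - F i y) *
            deriv (fun w => bsPrice (r i) (σ i) K T t w) s
          + ∫ v in Set.Ioo (0 : ℝ) (T - t),
              Real.exp (-(r i) * v) * (f i (y + v) / (1 - F i y)) *
                ∑ j, p i j * ∫ x in Set.Ioi (0 : ℝ),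
                  φ (t + v) x j 0 * lnKernel (r i) (σ i) x s v *
                    ((1 / s) * ((Real.log (x / s) - (r i - (σ i) ^ 2 / 2) * v) /
                      ((σ i) ^ 2 * v))))
        s := by
  intro t s y hD i
  obtain ⟨ht0, htT, hs, hy, hyt⟩ := hD
  simp only at ht0 htT hs hy hyt
  obtain ⟨C₀, hC₀⟩ := hφg
  obtain ⟨M₀, hM₀⟩ := hfbd i
  set C := max C₀ 0 with hCdef
  have hC : 0 ≤ C := le_max_right _ _
  set M := max M₀ 0 with hMdef
  have hM : 0 ≤ M := le_max_right _ _
  have hF1 : 0 < 1 - F i y := by have := hFlt i y hy.le; linarith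
  -- linear growth at age zero
  have hg : ∀ v, 0 < v → v < T - t → ∀ j, ∀ x, 0 < x → |φ (t + v) x j 0| ≤ C * (1 + x) := by
    intro v hv hvT j x hx
    have hmem : ((t + v, x, 0) : ℝ × ℝ × ℝ) ∈ domDbar T :=
      ⟨by simp only; linarith, by simp only; linarith, hx.le, le_rfl, by simp only; linarith⟩
    have h1 : ContinuousWithinAt (fun y => φ (t + v) x j y) (Set.Ioo 0 (t + v)) 0 := by
      have h2 := (hφc j) _ hmem
      refine ContinuousWithinAt.comp (f := fun y : ℝ => ((t + v, x, y) : ℝ × ℝ × ℝ))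
        (t := domDbar T) (g := fun q : ℝ × ℝ × ℝ => φ q.1 q.2.1 j q.2.2) h2 ?_ ?_
      · apply Continuous.continuousWithinAt; fun_prop
      · intro y hy
        exact ⟨by simp only; linarith, by simp only; linarith, hx.le, hy.1.le, hy.2.le⟩
    have hne : (nhdsWithin (0:ℝ) (Set.Ioo 0 (t + v))).NeBot := by
      rw [← mem_closure_iff_nhdsWithin_neBot, closure_Ioo (by linarith : (0:ℝ) ≠ t + v)]
      exact ⟨le_rfl, by linarith⟩
    refine le_of_tendsto h1.abs ?_
    filter_upwards [self_mem_nhdsWithin] with y hy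
    refine (hC₀ (t + v) x y ⟨?_, ?_, hx, hy.1, hy.2⟩ j).trans ?_
    · simp only; linarith
    · simp only; linarith
    · have := le_max_left C₀ 0
      gcongr
  have hgc2 : ∀ j, ContinuousOn (fun q : ℝ × ℝ => φ (t + q.1) q.2 j 0)
      (Set.Ioo 0 (T - t) ×ˢ Set.Ioi 0) := by
    intro j
    refine ContinuousOn.comp (f := fun q : ℝ × ℝ => ((t + q.1, q.2, 0) : ℝ × ℝ × ℝ))
        (t := domDbar T) (g := fun q : ℝ × ℝ × ℝ => φ q.1 q.2.1 j q.2.2) (hφc j) ?_ ?_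
    · apply Continuous.continuousOn; fun_prop
    · rintro ⟨v, x⟩ ⟨⟨hv, hvT⟩, hx⟩
      simp only [Set.mem_Ioi] at hv hvT hx
      exact ⟨by simp only; linarith, by simp only; linarith, hx.le, le_rfl, by simp only; linarith⟩
  have hgc : ∀ v, 0 < v → v < T - t → ∀ j, ContinuousOn (fun x => φ (t + v) x j 0) (Set.Ioi 0) := by
    intro v hv hvT j
    exact (hgc2 j).comp (f := fun x : ℝ => ((v, x) : ℝ × ℝ))
      (by apply Continuous.continuousOn; fun_prop) (fun x hx => ⟨⟨hv, hvT⟩, hx⟩)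
  have hgm : ∀ j, AEStronglyMeasurable (fun q : ℝ × ℝ => φ (t + q.1) q.2 j 0)
      ((volume.restrict (Set.Ioo 0 (T - t))).prod (volume.restrict (Set.Ioi (0:ℝ)))) := by
    intro j
    rw [Measure.prod_restrict]
    exact (hgc2 j).aestronglyMeasurable (measurableSet_Ioo.prod measurableSet_Ioi)
  have hcoef : AEStronglyMeasurable
      (fun v => Real.exp (-(r i) * v) * (f i (y + v) / (1 - F i y)))
      (volume.restrict (Set.Ioo 0 (T - t))) := by
    refine ContinuousOn.aestronglyMeasurable ?_ measurableSet_Ioo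
    have : ContinuousOn (fun v => f i (y + v)) (Set.Ioo 0 (T - t)) :=
      (hfC1 i).continuousOn.comp (by fun_prop) (fun v hv => by
        have := hv.1
        simp only [Set.mem_Ici]; linarith)
    exact (by fun_prop : ContinuousOn (fun v => Real.exp (-(r i) * v)) _).mul
      (this.div_const _)
  have hHm : ∀ w j, AEStronglyMeasurable (fun v => ∫ x in Set.Ioi (0 : ℝ),
      φ (t + v) x j 0 * lnKernel (r i) (σ i) x w v) (volume.restrict (Set.Ioo 0 (T - t))) := by
    intro w j
    refine AEStronglyMeasurable.integral_prod_right'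
      (f := fun q : ℝ × ℝ => φ (t + q.1) q.2 j 0 * lnKernel (r i) (σ i) q.2 w q.1)
      ((hgm j).mul (Measurable.aestronglyMeasurable ?_))
    unfold lnKernel lnL
    fun_prop
  have hH'm : ∀ w j, AEStronglyMeasurable (fun v => ∫ x in Set.Ioi (0 : ℝ),
      φ (t + v) x j 0 * lnKernel (r i) (σ i) x w v *
        ((1 / w) * ((Real.log (x / w) - (r i - (σ i) ^ 2 / 2) * v) / ((σ i) ^ 2 * v))))
      (volume.restrict (Set.Ioo 0 (T - t))) := by
    intro w j
    refine AEStronglyMeasurable.integral_prod_right'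
      (f := fun q : ℝ × ℝ => φ (t + q.1) q.2 j 0 * lnKernel (r i) (σ i) q.2 w q.1 *
        ((1 / w) * ((Real.log (q.2 / w) - (r i - (σ i) ^ 2 / 2) * q.1) / ((σ i) ^ 2 * q.1))))
      (((hgm j).mul (Measurable.aestronglyMeasurable ?_)).mul
        (Measurable.aestronglyMeasurable ?_))
    · unfold lnKernel lnL
      fun_prop
    · fun_prop
  obtain ⟨A, hA0, hA⟩ := H_bounds (r := r i) (V := T - t) hC (hσ i) hs
  have hcb : ∀ v, 0 < v → |Real.exp (-(r i) * v) * (f i (y + v) / (1 - F i y))| ≤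
      M / (1 - F i y) := by
    intro v hv
    have h1 : 0 ≤ f i (y + v) := hfnn i _ (by linarith)
    have h2 : f i (y + v) ≤ M := (hM₀ _ (by linarith)).trans (le_max_left _ _)
    rw [abs_of_nonneg (mul_nonneg (Real.exp_pos _).le (div_nonneg h1 hF1.le))]
    have h3 : Real.exp (-(r i) * v) ≤ 1 := Real.exp_le_one_iff.mpr (by
      have := mul_nonneg (hr i) hv.le; linarith)
    calc _ ≤ 1 * (M / (1 - F i y)) := by gcongr
      _ = _ := one_mul _
  have hsum : ∀ (h : Fin k → ℝ) (b : ℝ), (∀ j, |h j| ≤ b) → |∑ j, p i j * h j| ≤ b := by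
    intro h b hb
    calc |∑ j, p i j * h j| ≤ ∑ j, |p i j * h j| := Finset.abs_sum_le_sum_abs _ _
      _ ≤ ∑ j, p i j * b := by
        refine Finset.sum_le_sum fun j _ => ?_
        rw [abs_mul, abs_of_nonneg (hp0 i j)]
        exact mul_le_mul_of_nonneg_left (hb j) (hp0 i j)
      _ = b := by rw [← Finset.sum_mul, hp1 i, one_mul]
  have hsI : s ∈ Set.Ioo (s / 2) (2 * s) := ⟨by linarith, by linarith⟩
  have main : HasDerivAt (fun w => ∫ v in Set.Ioo (0 : ℝ) (T - t),
        Real.exp (-(r i) * v) * (f i (y + v) / (1 - F i y)) *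
          ∑ j, p i j * ∫ x in Set.Ioi (0 : ℝ), φ (t + v) x j 0 * lnKernel (r i) (σ i) x w v)
      (∫ v in Set.Ioo (0 : ℝ) (T - t),
              Real.exp (-(r i) * v) * (f i (y + v) / (1 - F i y)) *
                ∑ j, p i j * ∫ x in Set.Ioi (0 : ℝ),
                  φ (t + v) x j 0 * lnKernel (r i) (σ i) x s v *
                    ((1 / s) * ((Real.log (x / s) - (r i - (σ i) ^ 2 / 2) * v) /
                      ((σ i) ^ 2 * v)))) s := by
    refine (hasDerivAt_integral_of_dominated_loc_of_deriv_le
      (F := fun w v => Real.exp (-(r i) * v) * (f i (y + v) / (1 - F i y)) *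
          ∑ j, p i j * ∫ x in Set.Ioi (0 : ℝ), φ (t + v) x j 0 * lnKernel (r i) (σ i) x w v)
      (F' := fun w v => Real.exp (-(r i) * v) * (f i (y + v) / (1 - F i y)) *
                ∑ j, p i j * ∫ x in Set.Ioi (0 : ℝ),
                  φ (t + v) x j 0 * lnKernel (r i) (σ i) x w v *
                    ((1 / w) * ((Real.log (x / w) - (r i - (σ i) ^ 2 / 2) * v) /
                      ((σ i) ^ 2 * v))))
      (bound := fun v => M / (1 - F i y) * (A * (√v)⁻¹))
      (Ioo_mem_nhds hsI.1 hsI.2) ?_ ?_ ?_ ?_ ?_ ?_).2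
    · refine Filter.Eventually.of_forall fun w => hcoef.mul ?_
      exact Finset.aestronglyMeasurable_fun_sum _ fun j _ => (hHm w j).const_mul _
    · refine (integrable_const (M / (1 - F i y) * A)).mono' ?_ ?_
      · exact hcoef.mul
          (Finset.aestronglyMeasurable_fun_sum _ fun j _ => (hHm s j).const_mul _)
      · filter_upwards [ae_restrict_mem measurableSet_Ioo] with v hv
        rw [norm_mul, Real.norm_eq_abs, Real.norm_eq_abs]
        refine mul_le_mul (hcb v hv.1) (hsum _ _ fun j => ?_) (abs_nonneg _) (by positivity)
        exact (hA _ (hg v hv.1 hv.2 j) v hv.1 hv.2 s hsI).1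
    · exact hcoef.mul
          (Finset.aestronglyMeasurable_fun_sum _ fun j _ => (hH'm s j).const_mul _)
    · filter_upwards [ae_restrict_mem measurableSet_Ioo] with v hv
      intro w hw
      rw [norm_mul, Real.norm_eq_abs, Real.norm_eq_abs]
      refine mul_le_mul (hcb v hv.1) (hsum _ _ fun j => ?_) (abs_nonneg _) (by positivity)
      exact (hA _ (hg v hv.1 hv.2 j) v hv.1 hv.2 w hw).2
    · refine Integrable.const_mul (Integrable.const_mul ?_ _) _
      have h1 : IntervalIntegrable (fun v : ℝ => v ^ (-(1/2) : ℝ)) volume 0 (T - t) :=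
        intervalIntegral.intervalIntegrable_rpow' (by norm_num)
      rw [intervalIntegrable_iff_integrableOn_Ioo_of_le (by linarith)] at h1
      refine h1.congr ?_
      filter_upwards [ae_restrict_mem measurableSet_Ioo] with v hv
      rw [Real.rpow_neg hv.1.le, Real.sqrt_eq_rpow]
    · filter_upwards [ae_restrict_mem measurableSet_Ioo] with v hv
      intro w hw
      refine HasDerivAt.const_mul _ ?_
      refine HasDerivAt.fun_sum fun j _ => HasDerivAt.const_mul _ ?_
      have hw0 : 0 < w := by have := hw.1; linarith
      exact H_deriv hC (hσ i) hw0 hv.1 (hgc v hv.1 hv.2 j) (hg v hv.1 hv.2 j)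
  have hbs := (diff_bs (r := r i) (hσ i) hK htT hs).hasDerivAt.const_mul
    ((1 - F i (T - t + y)) / (1 - F i y))
  refine (hbs.add main).congr_of_eventuallyEq ?_
  filter_upwards [lt_mem_nhds hs] with w hw
  exact hφIE.1 t w y ⟨ht0, htT, hw, hy, hyt⟩ i
end
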